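/- arXiv:1410.7427 — 2 statements merged into one kernel-verified Lean document; each statement's English description precedes it below -/
import Mathlib

section
/- Let X be a real Banach space and Φ : X → ℝ a C¹ functional. Assume: (a) Φ is even, i.e. Φ(-u) = Φ(u) for all u ∈ X; (b) Φ is bounded from below; (c) Φ(0) = 0; (d) Φ satisfies the Palais–Smale condition; (e) for every natural number k ≥ 1 there exist a k-dimensional linear subspace X^k of X and a real number ρ_k > 0 such that sup{Φ(u) : u ∈ X^k, ‖u‖ = ρ_k} < 0. Then at least one of the following conclusions holds: (i) there exists a sequence (u_k) in X of critical points of Φ (i.e. the Fréchet derivative DΦ(u_k) = 0) with Φ(u_k) < 0 for all k and ‖u_k‖ → 0 as k → ∞; (ii) there exists r > 0 such that for every a with 0 < a < r there exists a critical point u of Φ with ‖u‖ = a and Φ(u) = 0. -/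
open Filter Topology


namespace ClarkExt

/-! ### Part 1: mod 2 chains on lists -/

section Chains
variable {X : Type*}

abbrev Ch (X : Type*) := List X →₀ ZMod 2

noncomputable def cone (b : X) : Ch X →ₗ[ZMod 2] Ch X := Finsupp.lmapDomain (ZMod 2) (ZMod 2) (List.cons b)

noncomputable def bdL : List X → Ch X
  | [] => 0
  | a :: l => Finsupp.single l 1 + cone a (bdL l)

noncomputable def bd : Ch X →ₗ[ZMod 2] Ch X := Finsupp.linearCombination (ZMod 2) bdL

lemma add_self_ch (c : Ch X) : c + c = 0 := by
  ext l; simp only [Finsupp.add_apply, Finsupp.coe_zero, Pi.zero_apply]; exact CharTwo.add_self_eq_zero _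

@[simp] lemma cone_single (b : X) (l : List X) (r : ZMod 2) :
    cone b (Finsupp.single l r) = Finsupp.single (b :: l) r := by
  simp [cone]

@[simp] lemma bd_single (l : List X) : bd (Finsupp.single l 1) = bdL l := by
  simp [bd]

lemma bd_cone (b : X) (c : Ch X) : bd (cone b c) = c + cone b (bd c) := by
  have : (bd ∘ₗ cone b : Ch X →ₗ[ZMod 2] Ch X) = LinearMap.id + cone b ∘ₗ bd := by
    apply Finsupp.lhom_ext'
    intro l
    apply LinearMap.ext_ring
    simp [bdL]
  exact LinearMap.congr_fun this c

lemma bd_bdL (l : List X) : bd (bdL l) = 0 := by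
  induction l with
  | nil => simp [bdL]
  | cons a l ih =>
    rw [bdL, map_add, bd_single, bd_cone, ih, map_zero, add_zero, add_self_ch]

lemma bd_bd (c : Ch X) : bd (bd c) = 0 := by
  have : (bd ∘ₗ bd : Ch X →ₗ[ZMod 2] Ch X) = 0 := by
    apply Finsupp.lhom_ext'
    intro l
    apply LinearMap.ext_ring
    simp [bd_bdL]
  exact LinearMap.congr_fun this c

/-- chains supported on a set of lists -/
noncomputable abbrev Sp (S : Set (List X)) : Submodule (ZMod 2) (Ch X) := Finsupp.supported (ZMod 2) (ZMod 2) S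

lemma single_mem_Sp {S : Set (List X)} {l : List X} (h : l ∈ S) : Finsupp.single l (1 : ZMod 2) ∈ Sp S :=
  Finsupp.single_mem_supported _ _ h

lemma Sp_induction {S : Set (List X)} {p : Ch X → Prop} (h0 : p 0)
    (hs : ∀ l ∈ S, p (Finsupp.single l 1)) (hadd : ∀ a b, p a → p b → p (a + b))
    {c : Ch X} (hc : c ∈ Sp S) : p c := by
  rw [Sp, Finsupp.supported_eq_span_single] at hc
  induction hc using Submodule.span_induction with
  | mem x hx => obtain ⟨l, hl, rfl⟩ := hx; exact hs l hl
  | zero => exact h0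
  | add x y _ _ hx hy => exact hadd _ _ hx hy
  | smul a x _ hx =>
    rcases (by decide : ∀ a : ZMod 2, a = 0 ∨ a = 1) a with rfl | rfl
    · simpa using h0
    · simpa using hx

lemma map_mem_Sp {Y : Type*} {S : Set (List X)} {T : Set (List Y)} (f : Ch X →ₗ[ZMod 2] Ch Y)
    (h : ∀ l ∈ S, f (Finsupp.single l 1) ∈ Sp T) {c : Ch X} (hc : c ∈ Sp S) : f c ∈ Sp T := by
  refine Sp_induction (p := fun c => f c ∈ Sp T) (by simp) h ?_ hc
  intro a b ha hb
  rw [map_add]; exact Submodule.add_mem _ ha hb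

lemma cone_mem_Sp {S T : Set (List X)} (b : X) (h : ∀ l ∈ S, b :: l ∈ T) {c : Ch X}
    (hc : c ∈ Sp S) : cone b c ∈ Sp T :=
  map_mem_Sp _ (fun l hl => by rw [cone_single]; exact single_mem_Sp (h l hl)) hc

lemma bdL_mem (l : List X) : bdL l ∈ Sp {l' | l'.length + 1 = l.length ∧ ∀ x ∈ l', x ∈ l} := by
  induction l with
  | nil => simp [bdL]
  | cons a l ih =>
    rw [bdL]
    refine Submodule.add_mem _ (single_mem_Sp ?_) (cone_mem_Sp a ?_ ih)
    · simp; intro x hx; exact Or.inr hx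
    · rintro l' ⟨h1, h2⟩
      refine ⟨by simp [h1], ?_⟩
      intro x hx
      rcases List.mem_cons.1 hx with h | h
      · simp [h]
      · exact List.mem_cons_of_mem _ (h2 x h)

/-- pushforward -/
noncomputable def push {Y : Type*} (f : X → Y) : Ch X →ₗ[ZMod 2] Ch Y :=
  Finsupp.lmapDomain (ZMod 2) (ZMod 2) (List.map f)

@[simp] lemma push_single {Y : Type*} (f : X → Y) (l : List X) (r : ZMod 2) :
    push f (Finsupp.single l r) = Finsupp.single (l.map f) r := by simp [push]

lemma push_cone {Y : Type*} (f : X → Y) (b : X) (c : Ch X) :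
    push f (cone b c) = cone (f b) (push f c) := by
  have : (push f ∘ₗ cone b : Ch X →ₗ[ZMod 2] Ch Y) = cone (f b) ∘ₗ push f := by
    apply Finsupp.lhom_ext'
    intro l
    apply LinearMap.ext_ring
    simp
  exact LinearMap.congr_fun this c

lemma push_bdL {Y : Type*} (f : X → Y) (l : List X) : push f (bdL l) = bdL (l.map f) := by
  induction l with
  | nil => simp [bdL]
  | cons a l ih => simp [bdL, push_cone, ih]

end Chains

section Sd
variable {X : Type*} [NormedAddCommGroup X] [NormedSpace ℝ X]

noncomputable def bary (l : List X) : X := (l.length : ℝ)⁻¹ • l.sum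

noncomputable def sdL : ℕ → List X → Ch X
  | 0, l => Finsupp.single l 1
  | n + 1, l => cone (bary l) (Finsupp.linearCombination (ZMod 2) (sdL n) (bdL l))

noncomputable def sd (n : ℕ) : Ch X →ₗ[ZMod 2] Ch X := Finsupp.linearCombination (ZMod 2) (sdL n)

@[simp] lemma sd_single (n : ℕ) (l : List X) : sd n (Finsupp.single l 1) = sdL n l := by simp [sd]

lemma sdL_succ (n : ℕ) (l : List X) : sdL (n+1) l = cone (bary l) (sd n (bdL l)) := rfl

lemma bd_sdL (n : ℕ) (l : List X) (hl : l.length = n + 1) :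
    bd (sdL (n + 1) l) = sd n (bdL l) := by
  induction n generalizing l with
  | zero =>
    rw [sdL_succ, bd_cone]
    match l, hl with
    | [a], _ => simp [bdL, sdL]
  | succ n ih =>
    rw [sdL_succ, bd_cone]
    have : ∀ c ∈ Sp {l' : List X | l'.length = n + 1}, bd (sd (n+1) c) = sd n (bd c) := by
      intro c hc
      refine Sp_induction (p := fun c => bd (sd (n+1) c) = sd n (bd c)) (by simp) ?_ ?_ hc
      · intro l' hl'
        simpa using ih l' hl'
      · intro a b ha hb; simp [ha, hb]
    rw [this (bdL l), bd_bdL]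
    · simp
    · refine Finsupp.supported_mono ?_ (bdL_mem l)
      rintro l' ⟨h1, _⟩
      simp only [Set.mem_ofPred_eq]; omega

lemma bd_sd (n : ℕ) {c : Ch X} (hc : c ∈ Sp {l : List X | l.length = n + 1}) :
    bd (sd (n + 1) c) = sd n (bd c) := by
  refine Sp_induction (p := fun c => bd (sd (n+1) c) = sd n (bd c)) (by simp) ?_ ?_ hc
  · intro l' hl'
    simpa using bd_sdL n l' hl'
  · intro a b ha hb; simp [ha, hb]

lemma bary_neg (l : List X) : bary (l.map Neg.neg) = - bary l := by
  have : (l.map Neg.neg).sum = - l.sum := by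
    induction l with
    | nil => simp
    | cons a l ih => simp [ih, add_comm]
  simp [bary, this]

lemma push_neg_sdL (n : ℕ) (l : List X) : push Neg.neg (sdL n l) = sdL n (l.map Neg.neg) := by
  induction n generalizing l with
  | zero => simp [sdL]
  | succ n ih =>
    rw [sdL_succ, sdL_succ, push_cone, bary_neg, ← push_bdL]
    congr 1
    have : (push Neg.neg ∘ₗ sd n : Ch X →ₗ[ZMod 2] Ch X) = sd n ∘ₗ push Neg.neg := by
      apply Finsupp.lhom_ext'
      intro l
      apply LinearMap.ext_ring
      simp [ih]
    exact LinearMap.congr_fun this _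

lemma push_neg_sd (n : ℕ) (c : Ch X) : push Neg.neg (sd n c) = sd n (push Neg.neg c) := by
  have : (push Neg.neg ∘ₗ sd n : Ch X →ₗ[ZMod 2] Ch X) = sd n ∘ₗ push Neg.neg := by
    apply Finsupp.lhom_ext'
    intro l
    apply LinearMap.ext_ring
    simp [push_neg_sdL]
  exact LinearMap.congr_fun this _

lemma dist_bary_le {n : ℕ} {l : List X} (hl : l.length = n + 1) {M q : ℝ} (hM : 0 ≤ M)
    (hq : (n : ℝ) ≤ q * (n + 1)) (h : ∀ x ∈ l, ∀ y ∈ l, dist x y ≤ M) {y : X} (hy : y ∈ l) :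
    dist y (bary l) ≤ q * M := by
  classical
  have hp := List.perm_cons_erase hy
  have hlen : (l.erase y).length = n := by rw [List.length_erase_of_mem hy]; omega
  have key : ∀ l' : List X, (∀ x ∈ l', dist x y ≤ M) → ‖l'.sum - (l'.length : ℝ) • y‖ ≤ l'.length * M := by
    intro l' h'
    induction l' with
    | nil => simp
    | cons a t ih =>
      have h1 := ih (fun x hx => h' x (List.mem_cons_of_mem _ hx))
      have h2 := h' a List.mem_cons_self
      rw [dist_eq_norm] at h2
      have : (a :: t).sum - ((a :: t).length : ℝ) • y = (a - y) + (t.sum - (t.length : ℝ) • y) := by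
        simp [add_smul]; abel
      rw [this]
      refine (norm_add_le _ _).trans ?_
      simp [add_mul]; linarith
  have h1 := key (l.erase y) (fun x hx => h x (List.mem_of_mem_erase hx) y hy)
  rw [hlen] at h1
  have hsum : l.sum = y + (l.erase y).sum := by rw [hp.sum_eq]; simp
  have hn : (0 : ℝ) < n + 1 := by positivity
  have : bary l - y = ((n : ℝ) + 1)⁻¹ • ((l.erase y).sum - (n : ℝ) • y) := by
    rw [bary, hl, hsum]
    push_cast
    generalize (l.erase y).sum = z
    have : y = ((n : ℝ) + 1)⁻¹ • (((n : ℝ) + 1) • y) := by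
      rw [smul_smul, inv_mul_cancel₀ hn.ne', one_smul]
    calc ((n : ℝ) + 1)⁻¹ • (y + z) - y
        = ((n : ℝ) + 1)⁻¹ • (y + z) - ((n : ℝ) + 1)⁻¹ • (((n : ℝ) + 1) • y) := by rw [← this]
      _ = _ := by
        rw [← smul_sub]; congr 1
        rw [add_smul, one_smul]; abel
  rw [dist_comm, dist_eq_norm, this, norm_smul, norm_inv, Real.norm_of_nonneg hn.le]
  rw [inv_mul_le_iff₀ hn]
  nlinarith

lemma bary_mem {n : ℕ} {l : List X} (hl : l.length = n + 1) {s : Set X} (hs : Convex ℝ s)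
    (h : ∀ x ∈ l, x ∈ s) : bary l ∈ s := by
  have key : ∀ (n : ℕ) (l : List X), l.length = n + 1 → (∀ x ∈ l, x ∈ s) → bary l ∈ s := by
    intro n
    induction n with
    | zero =>
      intro l hl h
      match l, hl with
      | [a], _ => simpa [bary] using h
    | succ n ih =>
      intro l hl h
      match l, hl with
      | a :: t, hl =>
        have ht : t.length = n + 1 := by simpa using hl
        have h1 := ih t ht (fun x hx => h x (List.mem_cons_of_mem _ hx))
        have h2 := h a List.mem_cons_self
        have hpos : (0 : ℝ) < n + 1 + 1 := by positivity
        have hpos' : (0 : ℝ) < n + 1 := by positivity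
        have := hs h2 h1 (a := ((n : ℝ) + 1 + 1)⁻¹) (b := ((n : ℝ) + 1 + 1)⁻¹ * (n + 1)) (by positivity)
          (by positivity) (by field_simp; ring)
        convert this using 1
        rw [bary, bary, hl, ht]
        push_cast
        rw [smul_smul, List.sum_cons, smul_add]
        congr 2
        field_simp
  exact key n l hl h

lemma sdL_mem (n : ℕ) (l : List X) (hl : l.length = n) {M q : ℝ} (hM : 0 ≤ M) (hq0 : 0 ≤ q)
    (hq : ∀ k : ℕ, k + 1 ≤ n → (k : ℝ) ≤ q * (k + 1)) (h : ∀ x ∈ l, ∀ y ∈ l, dist x y ≤ M) :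
    sdL n l ∈ Sp {l' : List X | l'.length = n ∧ (∀ x ∈ l', x ∈ convexHull ℝ {y | y ∈ l}) ∧
      ∀ x ∈ l', ∀ y ∈ l', dist x y ≤ q * M} := by
  induction n generalizing l with
  | zero =>
    have : l = [] := List.length_eq_zero_iff.1 hl
    subst this
    exact single_mem_Sp (by simp)
  | succ n ih =>
    rw [sdL_succ]
    have hball : convexHull ℝ {y | y ∈ l} ⊆ Metric.closedBall (bary l) (q * M) := by
      apply convexHull_min _ (convex_closedBall _ _)
      intro y hy
      exact dist_bary_le hl hM (hq n le_rfl) h hy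
    refine cone_mem_Sp (S := {l' : List X | l'.length = n ∧ (∀ x ∈ l', x ∈ convexHull ℝ {y | y ∈ l}) ∧
      ∀ x ∈ l', ∀ y ∈ l', dist x y ≤ q * M}) _ ?_ ?_
    · rintro l' ⟨h1, h2, h3⟩
      have hb : bary l ∈ convexHull ℝ {y | y ∈ l} :=
        bary_mem hl (convex_convexHull _ _) (fun x hx => subset_convexHull _ _ hx)
      refine ⟨by simp [h1], ?_, ?_⟩
      · intro x hx
        rcases List.mem_cons.1 hx with rfl | hx
        · exact hb
        · exact h2 x hx
      · intro x hx y hy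
        rcases List.mem_cons.1 hx with rfl | hx <;> rcases List.mem_cons.1 hy with rfl | hy
        · simp; positivity
        · rw [dist_comm]; exact hball (h2 y hy)
        · exact hball (h2 x hx)
        · exact h3 x hx y hy
    · refine map_mem_Sp _ ?_ (bdL_mem l)
      rintro l' ⟨h1, h2⟩
      rw [sd_single]
      refine Finsupp.supported_mono ?_ (ih l' (by omega) (fun k hk => hq k (by omega))
        (fun x hx y hy => h x (h2 x hx) y (h2 y hy)))
      rintro l'' ⟨h1', h2', h3'⟩
      exact ⟨h1', fun x hx => convexHull_mono (fun y hy => h2 y hy) (h2' x hx), h3'⟩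

end Sd
end ClarkExt
namespace ClarkExt

set_option linter.unusedSectionVars false

section Init
variable {X : Type*} [NormedAddCommGroup X] [NormedSpace ℝ X]

/-- sum of all signed simplices on the first `i` vectors -/
noncomputable def wCh (e : ℕ → X) : ℕ → Ch X
  | 0 => Finsupp.single [] 1
  | i + 1 => cone (e i) (wCh e i) + cone (- e i) (wCh e i)

lemma bd_wCh (e : ℕ → X) (i : ℕ) : bd (wCh e i) = 0 := by
  induction i with
  | zero => simp [wCh, bdL]
  | succ i ih => rw [wCh, map_add, bd_cone, bd_cone, ih, map_zero, map_zero, add_zero, add_self_ch]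

lemma push_wCh (e : ℕ → X) (i : ℕ) : push Neg.neg (wCh e i) = wCh e i := by
  induction i with
  | zero => simp [wCh]
  | succ i ih => rw [wCh, map_add, push_cone, push_cone, ih, neg_neg, add_comm]

/-- the signed faces -/
def Face (e : ℕ → X) (n : ℕ) (s : ℕ → Bool) : Set X :=
  convexHull ℝ {x | ∃ i < n, x = if s i then e i else - e i}

lemma wCh_mem (e : ℕ → X) (i : ℕ) : wCh e i ∈ Sp {l : List X | l.length = i ∧
    ∃ s : ℕ → Bool, ∀ x ∈ l, ∃ j < i, x = if s j then e j else - e j} := by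
  induction i with
  | zero => exact single_mem_Sp (by simp)
  | succ i ih =>
    refine Submodule.add_mem _ (cone_mem_Sp _ ?_ ih) (cone_mem_Sp _ ?_ ih)
    · rintro l ⟨h1, s, hs⟩
      refine ⟨by simp [h1], Function.update s i true, ?_⟩
      intro x hx
      rcases List.mem_cons.1 hx with rfl | hx
      · exact ⟨i, by omega, by simp⟩
      · obtain ⟨j, hj, rfl⟩ := hs x hx
        exact ⟨j, by omega, by rw [Function.update_of_ne (by omega)]⟩
    · rintro l ⟨h1, s, hs⟩
      refine ⟨by simp [h1], Function.update s i false, ?_⟩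
      intro x hx
      rcases List.mem_cons.1 hx with rfl | hx
      · exact ⟨i, by omega, by simp⟩
      · obtain ⟨j, hj, rfl⟩ := hs x hx
        exact ⟨j, by omega, by rw [Function.update_of_ne (by omega)]⟩

def Small (e : ℕ → X) (n : ℕ) (M : ℝ) (i : ℕ) : Set (List X) :=
  {l : List X | l.length = i ∧ (∃ s : ℕ → Bool, ∀ x ∈ l, x ∈ Face e n s) ∧
    ∀ x ∈ l, ∀ y ∈ l, dist x y ≤ M}

/-- Chain families -/
def Good (e : ℕ → X) (n : ℕ) (M : ℝ) : Prop :=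
  ∃ c : ℕ → Ch X, (∀ i < n, c i ∈ Sp (Small e n M (i + 1))) ∧
    bd (c 0) = Finsupp.single [] 1 ∧ ∀ i, i + 1 < n → bd (c (i + 1)) = c i + push Neg.neg (c i)

lemma good_init (e : ℕ → X) (n : ℕ) : ∃ M : ℝ, 0 ≤ M ∧ Good e n M := by
  refine ⟨2 * ∑ i ∈ Finset.range n, ‖e i‖, by positivity, fun i => cone (e i) (wCh e i), ?_, ?_, ?_⟩
  · intro i hi
    refine cone_mem_Sp _ ?_ (wCh_mem e i)
    rintro l ⟨h1, s, hs⟩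
    have key : ∀ x ∈ e i :: l, ∃ j < n, x = if Function.update s i true j then e j else - e j := by
      intro x hx
      rcases List.mem_cons.1 hx with rfl | hx
      · exact ⟨i, by omega, by simp⟩
      · obtain ⟨j, hj, rfl⟩ := hs x hx
        exact ⟨j, by omega, by rw [Function.update_of_ne (by omega)]⟩
    refine ⟨by simp [h1], ⟨Function.update s i true, fun x hx => subset_convexHull _ _ (key x hx)⟩, ?_⟩
    have hb : ∀ x ∈ e i :: l, ‖x‖ ≤ ∑ i ∈ Finset.range n, ‖e i‖ := by
      intro x hx
      obtain ⟨j, hj, rfl⟩ := key x hx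
      have : ‖e j‖ ≤ ∑ i ∈ Finset.range n, ‖e i‖ :=
        Finset.single_le_sum (f := fun i => ‖e i‖) (fun _ _ => norm_nonneg _) (Finset.mem_range.2 hj)
      split_ifs
      · exact this
      · rwa [norm_neg]
    intro x hx y hy
    have h1 := hb x hx
    have h2 := hb y hy
    rw [dist_eq_norm]
    linarith [norm_sub_le x y]
  · simp [wCh, bdL]
  · intro i _
    simp only
    rw [bd_cone, bd_wCh, map_zero, add_zero, push_cone, push_wCh, wCh]

lemma good_step (e : ℕ → X) (n : ℕ) {M : ℝ} (hM : 0 ≤ M) (h : Good e n M) :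
    Good e n ((n : ℝ) / (n + 1) * M) := by
  obtain ⟨c, h1, h2, h3⟩ := h
  have hn : (0 : ℝ) < n + 1 := by positivity
  have hlen : ∀ i < n, c i ∈ Sp {l : List X | l.length = i + 1} := fun i hi =>
    Finsupp.supported_mono (fun l hl => hl.1) (h1 i hi)
  by_cases hn0 : n = 0
  · subst hn0
    exact ⟨c, by simp, h2, by simp⟩
  refine ⟨fun i => sd (i + 1) (c i), ?_, ?_, ?_⟩
  · intro i hi
    refine map_mem_Sp _ ?_ (h1 i hi)
    rintro l ⟨a1, ⟨s, a2⟩, a3⟩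
    rw [sd_single]
    refine Finsupp.supported_mono ?_ (sdL_mem (i + 1) l a1 (q := (n : ℝ) / (n + 1)) hM (by positivity) ?_ a3)
    · rintro l' ⟨b1, b2, b3⟩
      exact ⟨b1, ⟨s, fun x hx => convexHull_min (fun y hy => a2 y hy) (convex_convexHull _ _) (b2 x hx)⟩, b3⟩
    · intro k hk
      have : (k : ℝ) ≤ n := by exact_mod_cast (by omega : k ≤ n)
      rw [div_mul_eq_mul_div, le_div_iff₀ hn]
      nlinarith
  · simp only
    rw [bd_sd 0 (hlen 0 (by omega)), h2]; simp [sdL]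
  · intro i hi
    simp only
    rw [bd_sd (i + 1) (hlen (i + 1) hi), h3 i hi, map_add, push_neg_sd]

lemma good_small (e : ℕ → X) (n : ℕ) {δ : ℝ} (hδ : 0 < δ) : ∃ M < δ, Good e n M := by
  obtain ⟨M, hM, h⟩ := good_init e n
  have hn : (0 : ℝ) < n + 1 := by positivity
  have key : ∀ k : ℕ, Good e n (((n : ℝ) / (n + 1)) ^ k * M) := by
    intro k
    induction k with
    | zero => simpa using h
    | succ k ih =>
      have := good_step e n (by positivity) ih
      rwa [← mul_assoc, ← pow_succ'] at this
  have ht : Tendsto (fun k : ℕ => ((n : ℝ) / (n + 1)) ^ k * M) atTop (𝓝 (0 * M)) := by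
    apply Tendsto.mul_const
    apply tendsto_pow_atTop_nhds_zero_of_lt_one (by positivity)
    rw [div_lt_one hn]; linarith
  rw [zero_mul] at ht
  obtain ⟨k, hk⟩ := (ht.eventually (gt_mem_nhds hδ)).exists
  exact ⟨_, hk, key k⟩

end Init

/-! ### Ky Fan lemma -/
section Fan

def alt : Bool → List Bool → ZMod 2
  | _, [] => 1
  | s, a :: l => if a = s then alt (!s) l else 0

def fs {L : Type*} : (List L → ZMod 2) → List L → ZMod 2
  | _, [] => 0
  | f, a :: l => f l + fs (fun m => f (a :: m)) l

lemma fs_zero {L : Type*} (l : List L) : fs (fun _ => 0) l = 0 := by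
  induction l with
  | nil => rfl
  | cons a l ih => simp [fs, ih]

lemma fs_perm {L : Type*} {l m : List L} (h : l.Perm m) (f : List L → ZMod 2)
    (hf : ∀ a b : List L, a.Perm b → f a = f b) : fs f l = fs f m := by
  induction h generalizing f with
  | nil => rfl
  | cons x h ih =>
    rw [fs, fs, hf _ _ h, ih]
    intro a b hab
    exact hf _ _ (hab.cons x)
  | swap x y l =>
    simp only [fs]
    have : (fun m => f (x :: y :: m)) = fun m => f (y :: x :: m) := by
      funext m; exact hf _ _ (List.Perm.swap _ _ _)
    rw [this]; ring
  | trans _ _ ih1 ih2 => exact (ih1 f hf).trans (ih2 f hf)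

lemma fs_congr {L : Type*} {l : List L} {f g : List L → ZMod 2}
    (h : ∀ m, m.Sublist l → f m = g m) : fs f l = fs g l := by
  induction l generalizing f g with
  | nil => rfl
  | cons a l ih =>
    rw [fs, fs, h l (List.sublist_cons_self _ _), ih]
    intro m hm
    exact h _ (hm.cons_cons a)

lemma fs_alt (s : Bool) (l : List Bool) : fs (alt s) l = alt s l + alt (!s) l := by
  induction l generalizing s with
  | nil => simp [fs, alt]; decide
  | cons a l ih =>
    rw [fs]
    by_cases h : a = s
    · subst h
      have h1 : (fun m => alt a (a :: m)) = alt (!a) := by funext m; simp [alt]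
      rw [h1, ih]
      simp only [alt, Bool.not_not, if_true]
      have : ¬ (a = !a) := by cases a <;> simp
      rw [if_neg this]
      have := CharTwo.add_self_eq_zero (alt a l)
      linear_combination this
    · have h1 : (fun m => alt s (a :: m)) = fun _ => 0 := by funext m; simp [alt, h]
      have h2 : a = !s := by cases a <;> cases s <;> simp_all
      rw [h1, fs_zero]
      simp [alt, h2]

lemma alt_not (s : Bool) (l : List Bool) : alt s (l.map not) = alt (!s) l := by
  induction l generalizing s with
  | nil => rfl
  | cons a l ih =>
    simp only [List.map_cons, alt, ih]
    cases a <;> cases s <;> simp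

lemma fs_map {L L' : Type*} (g : L → L') (f : List L' → ZMod 2) (l : List L) :
    fs f (l.map g) = fs (fun m => f (m.map g)) l := by
  induction l generalizing f with
  | nil => rfl
  | cons a l ih => simp [fs, ih]

abbrev Lab (n : ℕ) := Fin n ×ₗ Bool

def lneg {n : ℕ} (a : Lab n) : Lab n := toLex ((ofLex a).1, !(ofLex a).2)

def sgn {n : ℕ} (a : Lab n) : Bool := (ofLex a).2

def fanA {n : ℕ} (l : List (Lab n)) : ZMod 2 := alt true ((l.insertionSort (· ≤ ·)).map sgn)

lemma fanA_perm {n : ℕ} (a b : List (Lab n)) (h : a.Perm b) : fanA a = fanA b := by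
  have : a.insertionSort (· ≤ ·) = b.insertionSort (· ≤ ·) := by
    apply List.Perm.eq_of_pairwise (le := (· ≤ ·))
    · intro x y _ _ h1 h2; exact le_antisymm h1 h2
    · exact List.pairwise_insertionSort _ _
    · exact List.pairwise_insertionSort _ _
    · exact ((List.perm_insertionSort _ _).trans h).trans (List.perm_insertionSort _ _).symm
  rw [fanA, fanA, this]

def NoComp {n : ℕ} (l : List (Lab n)) : Prop := ∀ a ∈ l, ∀ b ∈ l, a ≠ lneg b

lemma lneg_le {n : ℕ} {a b : Lab n} (h : a ≠ lneg b) (hab : a ≤ b) : lneg a ≤ lneg b := by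
  revert h hab
  obtain ⟨⟨a1, a2⟩, rfl⟩ := toLex.surjective a
  obtain ⟨⟨b1, b2⟩, rfl⟩ := toLex.surjective b
  simp only [lneg, ofLex_toLex, Prod.Lex.toLex_le_toLex]
  intro h hab
  rcases hab with hab | ⟨hab, h2⟩
  · exact Or.inl hab
  · right
    refine ⟨hab, ?_⟩
    subst hab
    cases a2 <;> cases b2 <;> simp_all

lemma fanA_neg {n : ℕ} {l : List (Lab n)} (h : NoComp l) :
    fanA (l.map lneg) = alt false ((l.insertionSort (· ≤ ·)).map sgn) := by
  have : (l.map lneg).insertionSort (· ≤ ·) = (l.insertionSort (· ≤ ·)).map lneg := by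
    apply List.Perm.eq_of_pairwise (le := (· ≤ ·))
    · intro x y _ _ h1 h2; exact le_antisymm h1 h2
    · exact List.pairwise_insertionSort _ _
    · rw [List.pairwise_map]
      refine (List.pairwise_insertionSort (· ≤ ·) l).imp_of_mem ?_
      intro a b ha hb hab
      rw [List.mem_insertionSort] at ha hb
      exact lneg_le (h a ha b hb) hab
    · exact (List.perm_insertionSort _ _).trans ((List.perm_insertionSort _ _).symm.map _)
  rw [fanA, this, List.map_map]
  have h2 : (sgn ∘ lneg : Lab n → Bool) = not ∘ sgn := by funext a; simp [sgn, lneg]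
  rw [h2, ← List.map_map, alt_not]; rfl

lemma fan_id {n : ℕ} {l : List (Lab n)} (h : NoComp l) :
    fs fanA l = fanA l + fanA (l.map lneg) := by
  rw [fanA_neg h, ← fs_perm (List.perm_insertionSort (· ≤ ·) l) _ fanA_perm]
  rw [fs_congr (g := fun m => alt true (m.map sgn)), ← fs_map, fs_alt]
  · rfl
  · intro m hm
    rw [fanA, List.Pairwise.insertionSort_eq]
    exact (List.pairwise_insertionSort _ l).sublist hm

lemma alt_len {n : ℕ} (s : Bool) (l : List (Lab n)) (h : NoComp l) (hs : l.Pairwise (· ≤ ·))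
    (ha : alt s (l.map sgn) ≠ 0) : (l.map (fun a => (ofLex a).1)).Pairwise (· < ·) := by
  induction l generalizing s with
  | nil => simp
  | cons a l ih =>
    have h' : NoComp l := fun x hx y hy => h x (List.mem_cons_of_mem _ hx) y (List.mem_cons_of_mem _ hy)
    simp only [List.map_cons, alt] at ha
    split_ifs at ha with h1
    swap
    · exact absurd rfl ha
    rw [List.pairwise_cons] at hs
    rw [List.map_cons, List.pairwise_cons]
    refine ⟨?_, ih _ h' hs.2 ha⟩
    match l, hs, ha with
    | [], _, _ => simp
    | b :: t, hs, ha =>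
      simp only [List.map_cons, alt] at ha
      split_ifs at ha with h2
      swap
      · exact absurd rfl ha
      have hab : (ofLex a).1 < (ofLex b).1 := by
        have h3 := hs.1 b List.mem_cons_self
        have h4 := h a List.mem_cons_self b (by simp)
        revert h1 h2 h3 h4
        obtain ⟨⟨a1, a2⟩, rfl⟩ := toLex.surjective a
        obtain ⟨⟨b1, b2⟩, rfl⟩ := toLex.surjective b
        simp only [lneg, ofLex_toLex, Prod.Lex.toLex_le_toLex, sgn]
        intro h1 h2 h3 h4
        rcases h3 with h3 | ⟨h3, _⟩
        · exact h3
        · exfalso; apply h4; subst h3 h1 h2; simp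
      intro i hi
      obtain ⟨x, hx, rfl⟩ := List.mem_map.1 hi
      rcases List.mem_cons.1 hx with rfl | hx
      · exact hab
      · have := (List.pairwise_cons.1 hs.2).1 x hx
        rcases Prod.Lex.le_iff.1 this with h5 | h5
        · exact hab.trans h5
        · rw [← h5.1]; exact hab

lemma fanA_long {n : ℕ} {l : List (Lab n)} (h : NoComp l) (hl : n < l.length) : fanA l = 0 := by
  by_contra hne
  have h1 := alt_len true (l.insertionSort (· ≤ ·))
    (fun a ha b hb => h a ((List.mem_insertionSort _).1 ha) b ((List.mem_insertionSort _).1 hb))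
    (List.pairwise_insertionSort _ _) hne
  have h2 : (((l.insertionSort (· ≤ ·))).map (fun a => (ofLex a).1)).Nodup :=
    h1.imp (fun h => ne_of_lt h)
  have := h2.length_le_card
  simp at this
  omega

end Fan
end ClarkExt
namespace ClarkExt

section BU
variable {X : Type*} [NormedAddCommGroup X] [NormedSpace ℝ X]

lemma lin_bdL {X : Type*} (f : List X → ZMod 2) (l : List X) :
    Finsupp.linearCombination (ZMod 2) f (bdL l) = fs f l := by
  induction l generalizing f with
  | nil => simp [bdL, fs]
  | cons a l ih =>
    have : ∀ c : Ch X, Finsupp.linearCombination (ZMod 2) f (cone a c) =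
        Finsupp.linearCombination (ZMod 2) (fun m => f (a :: m)) c := by
      intro c
      have : (Finsupp.linearCombination (ZMod 2) f ∘ₗ cone a : Ch X →ₗ[ZMod 2] ZMod 2) =
          Finsupp.linearCombination (ZMod 2) (fun m => f (a :: m)) := by
        apply Finsupp.lhom_ext'
        intro l
        apply LinearMap.ext_ring
        simp
      exact LinearMap.congr_fun this c
    rw [bdL, map_add, this, ih, fs]
    simp

open Classical in
noncomputable def lamI {n : ℕ} [Nonempty (Fin n)] (G : Fin n → Set X) (x : X) : Fin n :=
  Classical.epsilon (fun i => x ∈ G i ∨ -x ∈ G i)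

open Classical in
noncomputable def lam {n : ℕ} [Nonempty (Fin n)] (G : Fin n → Set X) (x : X) : Lab n :=
  toLex (lamI G x, decide (x ∈ G (lamI G x)))

theorem borsuk_cover (e : ℕ → X) (n : ℕ) (G : Fin n → Set X) (hG : ∀ i, IsClosed (G i))
    (hd : ∀ i, ∀ x ∈ G i, -x ∉ G i)
    (hc : ∀ s, ∀ x ∈ Face e (n + 1) s, ∃ i, x ∈ G i ∨ -x ∈ G i) : False := by
  have hne : Nonempty (Fin n) := by
    obtain ⟨i, _⟩ := hc (fun _ => true) (e 0) (subset_convexHull _ _ ⟨0, by omega, by simp⟩)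
    exact ⟨i⟩
  set B : Set X := convexHull ℝ ((e '' Set.Iio (n+1)) ∪ ((fun i => - e i) '' Set.Iio (n + 1))) with hB
  have hBc : IsCompact B :=
    (((Set.finite_Iio _).image _).union ((Set.finite_Iio _).image _)).isCompact_convexHull (𝕜 := ℝ)
  have hFB : ∀ s, Face e (n+1) s ⊆ B := by
    intro s
    apply convexHull_mono
    rintro x ⟨i, hi, rfl⟩
    split_ifs
    · exact Or.inl ⟨i, hi, rfl⟩
    · exact Or.inr ⟨i, hi, rfl⟩
  have hδ : ∃ δ > 0, ∀ i, ∀ x ∈ B, x ∈ G i → ∀ y, -y ∈ G i → δ ≤ dist x y := by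
    have : ∀ i, ∃ δ > 0, ∀ x ∈ B, x ∈ G i → ∀ y, -y ∈ G i → δ ≤ dist x y := by
      intro i
      obtain ⟨r, hr, h⟩ := Metric.exists_pos_forall_lt_edist (hBc.inter_right (hG i))
        ((hG i).preimage continuous_neg) (by
          rw [Set.disjoint_left]
          rintro x ⟨_, hx⟩ hx'
          exact hd i x hx hx')
      refine ⟨r, by exact_mod_cast hr, fun x hx hxi y hy => ?_⟩
      have := h x ⟨hx, hxi⟩ y hy
      rw [edist_nndist] at this
      have h2 : r < nndist x y := by exact_mod_cast this
      rw [← coe_nndist]; exact_mod_cast h2.le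
    choose δ h1 h2 using this
    refine ⟨Finset.univ.inf' Finset.univ_nonempty δ, ?_, ?_⟩
    · rw [gt_iff_lt, Finset.lt_inf'_iff]; intro i _; exact h1 i
    · intro i x hx hxi y hy
      exact (Finset.inf'_le _ (Finset.mem_univ i)).trans (h2 i x hx hxi y hy)
  obtain ⟨δ, hδ0, hδ⟩ := hδ
  obtain ⟨M, hMδ, c, c1, c2, c3⟩ := good_small e (n + 1) hδ0
  -- labels
  have hcov : ∀ s, ∀ x ∈ Face e (n + 1) s, x ∈ G (lamI G x) ∨ - x ∈ G (lamI G x) := by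
    intro s x hx
    exact Classical.epsilon_spec (p := fun i => x ∈ G i ∨ -x ∈ G i) (hc s x hx)
  have hnegI : ∀ x, lamI G (-x) = lamI G x := by
    intro x
    rw [lamI, lamI]
    congr 1
    funext i
    rw [neg_neg, or_comm]
  have hneg : ∀ s, ∀ x ∈ Face e (n + 1) s, lam G (-x) = lneg (lam G x) := by
    intro s x hx
    rw [lam, lam, lneg, hnegI]
    simp only [ofLex_toLex]
    congr 2
    rcases hcov s x hx with h | h
    · have := hd _ _ h
      simp [h, this]
    · have := hd _ _ h
      rw [neg_neg] at this
      simp [h, this]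
  have hnc : ∀ s, ∀ x ∈ Face e (n + 1) s, ∀ y ∈ Face e (n + 1) s, dist x y < δ →
      lam G x ≠ lneg (lam G y) := by
    intro s x hx y hy hxy heq
    rw [lam, lam, lneg] at heq
    have h1 := congrArg (fun a => (ofLex a).1) heq
    have h2 := congrArg (fun a => (ofLex a).2) heq
    simp only [ofLex_toLex] at h1 h2
    by_cases hxG : x ∈ G (lamI G x)
    · have : y ∉ G (lamI G y) := by
        intro h; simp [hxG, h] at h2
      have h3 := (hcov s y hy).resolve_left this
      rw [← h1] at h3
      exact absurd (hδ _ x (hFB s hx) hxG y h3) (not_le.2 hxy)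
    · have : y ∈ G (lamI G y) := by
        by_contra h; simp [hxG, h] at h2
      have h3 := (hcov s x hx).resolve_left hxG
      rw [h1] at h3
      rw [dist_comm] at hxy
      exact absurd (hδ _ y (hFB s hy) this x h3) (not_le.2 hxy)
  set Λ : Ch X →ₗ[ZMod 2] ZMod 2 :=
    Finsupp.linearCombination (ZMod 2) (fun l : List X => fanA (l.map (lam G))) with hΛ
  have hNC : ∀ i, ∀ l ∈ Small e (n+1) M i, NoComp (l.map (lam G)) := by
    rintro i l ⟨_, ⟨s, h2⟩, h3⟩ a ha b hb
    obtain ⟨x, hx, rfl⟩ := List.mem_map.1 ha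
    obtain ⟨y, hy, rfl⟩ := List.mem_map.1 hb
    exact hnc s x (h2 x hx) y (h2 y hy) ((h3 x hx y hy).trans_lt hMδ)
  have hmapneg : ∀ i, ∀ l ∈ Small e (n+1) M i,
      (l.map Neg.neg).map (lam G) = (l.map (lam G)).map lneg := by
    rintro i l ⟨_, ⟨s, h2⟩, h3⟩
    rw [List.map_map, List.map_map]
    apply List.map_congr_left
    intro x hx
    exact hneg s x (h2 x hx)
  have hid : ∀ i, ∀ d ∈ Sp (Small e (n+1) M i), Λ (bd d) = Λ d + Λ (push Neg.neg d) := by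
    intro i d hd
    refine Sp_induction (p := fun d => Λ (bd d) = Λ d + Λ (push Neg.neg d)) (by simp) ?_ ?_ hd
    · intro l hl
      rw [bd_single, hΛ, lin_bdL, ← fs_map, fan_id (hNC i l hl)]
      simp [← hmapneg i l hl]
    · intro a b ha hb
      simp only [map_add, ha, hb]; ring
  have hone : ∀ i, i < n + 1 → Λ (bd (c i)) = 1 := by
    intro i
    induction i with
    | zero => intro _; rw [c2]; simp [hΛ, fanA, alt]
    | succ i ih =>
      intro hi
      rw [c3 i hi, map_add, ← hid _ _ (c1 i (by omega)), ih (by omega)]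
  have h1 := hone n (by omega)
  have h2 : Λ (c n) + Λ (push Neg.neg (c n)) = 0 := by
    refine Sp_induction (p := fun d => Λ d + Λ (push Neg.neg d) = 0) (by simp) ?_ ?_ (c1 n (by omega))
    · intro l hl
      have hlen : l.length = n + 1 := hl.1
      have e1 : fanA (l.map (lam G)) = 0 := fanA_long (hNC _ l hl) (by simp [hlen])
      have e2 : fanA ((l.map (lam G)).map lneg) = 0 := by
        have := fan_id (hNC _ l hl)
        apply fanA_long _ (by simp [hlen])
        intro a ha b hb hab
        obtain ⟨x, hx, rfl⟩ := List.mem_map.1 ha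
        obtain ⟨y, hy, rfl⟩ := List.mem_map.1 hb
        refine hNC _ l hl x hx y hy ?_
        have := congrArg lneg hab
        simpa [lneg] using this
      rw [← hmapneg _ l hl] at e2
      simp [hΛ, e1]
      simpa using e2
    · intro a b ha hb
      simp only [map_add]; linear_combination ha + hb
  rw [hid _ _ (c1 n (by omega)), h2] at h1
  exact zero_ne_one h1

/-- covering number at most `n`. -/
def Gen (A : Set X) (n : ℕ) : Prop :=
  ∃ F : Fin n → Set X, (∀ i, IsClosed (F i)) ∧ (∀ i, ∀ x ∈ F i, -x ∉ F i) ∧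
    ∀ x ∈ A, ∃ i, x ∈ F i ∨ -x ∈ F i

lemma Gen.mono {A B : Set X} {n : ℕ} (h : Gen B n) (hAB : A ⊆ B) : Gen A n := by
  obtain ⟨F, h1, h2, h3⟩ := h
  exact ⟨F, h1, h2, fun x hx => h3 x (hAB hx)⟩

lemma Gen.union {A B : Set X} {n m : ℕ} (hA : Gen A n) (hB : Gen B m) : Gen (A ∪ B) (n + m) := by
  obtain ⟨F, h1, h2, h3⟩ := hA
  obtain ⟨F', h1', h2', h3'⟩ := hB
  refine ⟨Fin.append F F', ?_, ?_, ?_⟩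
  · intro i
    refine Fin.addCases (fun i => ?_) (fun i => ?_) i
    · simpa using h1 i
    · simpa using h1' i
  · intro i
    refine Fin.addCases (fun i => ?_) (fun i => ?_) i
    · simpa using h2 i
    · simpa using h2' i
  · rintro x (hx | hx)
    · obtain ⟨i, hi⟩ := h3 x hx
      exact ⟨Fin.castAdd m i, by simpa using hi⟩
    · obtain ⟨i, hi⟩ := h3' x hx
      exact ⟨Fin.natAdd n i, by simpa using hi⟩

theorem sphere_not_gen {n : ℕ} (V : Submodule ℝ X) (hV : Module.finrank ℝ V = n + 1) {ρ : ℝ} (hρ : 0 < ρ)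
    (h : Gen {u : X | u ∈ V ∧ ‖u‖ = ρ} n) : False := by
  obtain ⟨F, h1, h2, h3⟩ := h
  have : FiniteDimensional ℝ V := Module.finite_of_finrank_pos (by omega)
  let b := Module.finBasisOfFinrankEq ℝ V hV
  let e : ℕ → X := fun i => if h : i < n + 1 then (b ⟨i, h⟩ : X) else 0
  -- faces
  have hface : ∀ s, ∀ x ∈ Face e (n+1) s, x ∈ V ∧ x ≠ 0 := by
    intro s x hx
    let φ : V →ₗ[ℝ] ℝ := b.constr ℝ (fun i => if s i then (1 : ℝ) else -1)
    have hsub : Face e (n+1) s ⊆ Subtype.val '' {v : V | φ v = 1} := by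
      apply convexHull_min
      · rintro x ⟨i, hi, rfl⟩
        refine ⟨if s i then b ⟨i, hi⟩ else - b ⟨i, hi⟩, ?_, ?_⟩
        · have : φ (b ⟨i, hi⟩) = if s i then (1 : ℝ) else -1 := by
            exact b.constr_basis ℝ _ _
          split_ifs with hs
          · simpa [hs] using this
          · simp [this, hs]
        · split_ifs <;> simp [e] <;> (intro h; omega)
      · have hcv : Convex ℝ {v : V | φ v = 1} := by
          intro u hu v hv a c _ _ hac
          have hu : φ u = 1 := hu
          have hv : φ v = 1 := hv
          show φ (a • u + c • v) = 1
          rw [map_add, map_smul, map_smul, hu, hv]; simpa using hac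
        exact hcv.linear_image V.subtype
    obtain ⟨v, hv, rfl⟩ := hsub hx
    refine ⟨v.2, ?_⟩
    intro h0
    have : v = 0 := by exact_mod_cast h0
    subst this
    simp at hv
  -- radial projection
  have hQ : IsClosed (⋃ s ∈ (Set.univ : Set (ℕ → Bool)), Face e (n+1) s) := by
    have : (⋃ s ∈ (Set.univ : Set (ℕ → Bool)), Face e (n+1) s) =
        ⋃ s : Fin (n+1) → Bool, Face e (n+1) (fun i => if h : i < n + 1 then s ⟨i, h⟩ else true) := by
      apply Set.Subset.antisymm
      · intro x hx
        simp only [Set.mem_univ, Set.iUnion_true, Set.mem_iUnion] at hx ⊢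
        obtain ⟨s, hs⟩ := hx
        refine ⟨fun i => s i, ?_⟩
        convert hs using 1
        unfold Face
        congr 1
        ext y
        constructor
        · rintro ⟨i, hi, rfl⟩; exact ⟨i, hi, by simp [hi]⟩
        · rintro ⟨i, hi, rfl⟩; exact ⟨i, hi, by simp [hi]⟩
      · intro x hx
        simp only [Set.mem_univ, Set.iUnion_true, Set.mem_iUnion] at hx ⊢
        obtain ⟨s, hs⟩ := hx
        exact ⟨_, hs⟩
    rw [this]
    apply isClosed_iUnion_of_finite
    intro s
    apply IsCompact.isClosed
    apply Set.Finite.isCompact_convexHull (𝕜 := ℝ)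
    refine ((Set.finite_Iio (n+1)).image (fun i => if (if h : i < n + 1 then s ⟨i, h⟩ else true) then e i else - e i)).subset ?_
    rintro x ⟨i, hi, rfl⟩
    exact ⟨i, hi, rfl⟩
  set Q := (⋃ s ∈ (Set.univ : Set (ℕ → Bool)), Face e (n+1) s) with hQdef
  have hQ0 : ∀ x ∈ Q, x ∈ V ∧ x ≠ 0 := by
    intro x hx
    simp only [hQdef, Set.mem_univ, Set.iUnion_true, Set.mem_iUnion] at hx
    obtain ⟨s, hs⟩ := hx
    exact hface s x hs
  let p : X → X := fun x => (ρ * ‖x‖⁻¹) • x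
  have hp : ContinuousOn p (Q ∪ -Q) := by
    intro x hx
    have hx0 : x ≠ 0 := by
      rcases hx with hx | hx
      · exact (hQ0 x hx).2
      · have := (hQ0 _ hx).2; simpa using this
    apply ContinuousAt.continuousWithinAt
    have : ‖x‖ ≠ 0 := norm_ne_zero_iff.2 hx0
    fun_prop (disch := assumption)
  have hQn : IsClosed (Q ∪ -Q) := hQ.union hQ.neg
  refine borsuk_cover e n (fun i => (Q ∪ -Q) ∩ p ⁻¹' (F i)) (fun i => hp.preimage_isClosed_of_isClosed hQn (h1 i))
    ?_ ?_
  · rintro i x ⟨_, hx⟩ ⟨_, hx'⟩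
    apply h2 i _ hx
    simpa [p] using hx'
  · intro s x hx
    have hxQ : x ∈ Q := by
      simp only [hQdef, Set.mem_univ, Set.iUnion_true, Set.mem_iUnion]
      exact ⟨s, hx⟩
    obtain ⟨hxV, hx0⟩ := hface s x hx
    have hn : ‖x‖ ≠ 0 := norm_ne_zero_iff.2 hx0
    obtain ⟨i, hi⟩ := h3 (p x) ⟨V.smul_mem _ hxV, by
      simp [p, norm_smul, abs_of_pos hρ]; field_simp⟩
    refine ⟨i, ?_⟩
    rcases hi with hi | hi
    · exact Or.inl ⟨Or.inl hxQ, hi⟩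
    · refine Or.inr ⟨Or.inr (by simpa using hxQ), ?_⟩
      simpa [p] using hi

end BU
end ClarkExt
namespace ClarkExt

section Deform

lemma caristi {E : Type*} [MetricSpace E] [CompleteSpace E] [Nonempty E] (F : E → ℝ)
    (hF : Continuous F) (m : ℝ) (hm : ∀ h, m ≤ F h) (σ : ℝ) (hσ : 0 < σ)
    (H : ∀ h, ∃ h', h' ≠ h ∧ F h' ≤ F h - σ * dist h h') : False := by
  let S : E → Set E := fun h => {h' | F h' ≤ F h - σ * dist h h'}
  have hself : ∀ h, h ∈ S h := fun h => by simp [S]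
  have htrans : ∀ h h', h' ∈ S h → S h' ⊆ S h := by
    intro h h' h1 h'' h2
    have h1 : F h' ≤ F h - σ * dist h h' := h1
    have h2 : F h'' ≤ F h' - σ * dist h' h'' := h2
    show F h'' ≤ F h - σ * dist h h''
    nlinarith [dist_triangle h h' h'']
  have hbdd : ∀ h, BddBelow (F '' S h) := fun h => ⟨m, by rintro _ ⟨x, _, rfl⟩; exact hm x⟩
  have hnext : ∀ h, ∃ h' ∈ S h, F h' ≤ (F h + sInf (F '' S h)) / 2 := by
    intro h
    have hle : sInf (F '' S h) ≤ F h := csInf_le (hbdd h) ⟨h, hself h, rfl⟩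
    rcases hle.eq_or_lt with he | hlt
    · exact ⟨h, hself h, by linarith⟩
    · obtain ⟨_, ⟨h', hh', rfl⟩, hlt'⟩ := exists_lt_of_csInf_lt (s := F '' S h) ⟨_, h, hself h, rfl⟩
        (show sInf (F '' S h) < (F h + sInf (F '' S h)) / 2 by linarith)
      exact ⟨h', hh', hlt'.le⟩
  choose nx hnx1 hnx2 using hnext
  obtain ⟨h0⟩ := ‹Nonempty E›
  let u : ℕ → E := fun n => nx^[n] h0
  have hu : ∀ n, u (n + 1) = nx (u n) := fun n => Function.iterate_succ_apply' _ _ _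
  have hmono : ∀ n k, u (n + k) ∈ S (u n) := by
    intro n k
    induction k with
    | zero => exact hself _
    | succ k ih =>
      rw [← add_assoc, hu]
      exact htrans _ _ ih (hnx1 _)
  have hanti : Antitone (F ∘ u) := by
    apply antitone_nat_of_succ_le
    intro n
    have : F (u (n+1)) ≤ F (u n) - σ * dist (u n) (u (n+1)) := hmono n 1
    have h2 : 0 ≤ σ * dist (u n) (u (n+1)) := by positivity
    simp only [Function.comp]; linarith
  have hb : BddBelow (Set.range (F ∘ u)) := ⟨m, by rintro _ ⟨n, rfl⟩; exact hm _⟩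
  have hlim := tendsto_atTop_ciInf hanti hb
  set L := ⨅ n, (F ∘ u) n with hL
  have hLle : ∀ n, L ≤ F (u n) := fun n => ciInf_le hb n
  have hcau : CauchySeq u := by
    rw [Metric.cauchySeq_iff']
    intro ε hε
    have : ∀ᶠ n in atTop, (F ∘ u) n < L + σ * ε := hlim.eventually (gt_mem_nhds (by nlinarith))
    obtain ⟨N, hN⟩ := this.exists
    refine ⟨N, fun n hn => ?_⟩
    obtain ⟨k, rfl⟩ := Nat.exists_eq_add_of_le hn
    have h1 : F (u (N + k)) ≤ F (u N) - σ * dist (u N) (u (N+k)) := hmono N k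
    have h2 := hLle (N + k)
    simp only [Function.comp] at hN
    rw [dist_comm]
    by_contra hcon
    push Not at hcon
    nlinarith
  obtain ⟨x, hx⟩ := cauchySeq_tendsto_of_complete hcau
  have hFx : F x = L := tendsto_nhds_unique ((hF.tendsto x).comp hx) hlim
  have hxS : ∀ n, x ∈ S (u n) := by
    intro n
    have hclosed : IsClosed (S (u n)) := isClosed_le hF (by fun_prop)
    have : Tendsto (fun k => u (n + k)) atTop (𝓝 x) := by
      have := hx.comp (tendsto_add_atTop_nat n)
      refine this.congr (fun k => ?_)
      simp [add_comm]
    exact hclosed.mem_of_tendsto this (Eventually.of_forall (hmono n))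
  obtain ⟨y, hyx, hy⟩ := H x
  have hyS : ∀ n, y ∈ S (u n) := fun n => htrans _ _ (hxS n) hy
  have hge : ∀ n, 2 * F (u (n+1)) - F (u n) ≤ F y := by
    intro n
    have h1 : sInf (F '' S (u n)) ≤ F y := csInf_le (hbdd _) ⟨y, hyS n, rfl⟩
    have h2 := hnx2 (u n)
    rw [← hu] at h2
    linarith
  have hlim2 : Tendsto (fun n => 2 * F (u (n+1)) - F (u n)) atTop (𝓝 (2 * L - L)) :=
    ((hlim.comp (tendsto_add_atTop_nat 1)).const_mul 2).sub hlim
  have h3 := le_of_tendsto' hlim2 hge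
  have h4 : 0 < dist x y := dist_pos.2 hyx.symm
  nlinarith

lemma eventually_segment {Y : Type*} [TopologicalSpace Y] {p : ℝ → Y → Prop} {y : Y}
    (h : ∀ᶠ z : ℝ × Y in 𝓝 (0, y), p z.1 z.2) :
    ∀ᶠ z : ℝ × Y in 𝓝 (0, y), ∀ τ, 0 ≤ τ → τ ≤ z.1 → p τ z.2 := by
  rw [nhds_prod_eq, Filter.eventually_prod_iff] at h ⊢
  obtain ⟨pa, ha, pb, hb, hab⟩ := h
  rw [Metric.eventually_nhds_iff] at ha
  obtain ⟨r, hr, ha⟩ := ha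
  refine ⟨fun t => |t| < r, ?_, pb, hb, ?_⟩
  · rw [Metric.eventually_nhds_iff]
    exact ⟨r, hr, fun t ht => by simpa [Real.dist_eq] using ht⟩
  · intro t ht y hy τ h0 h1
    refine hab (ha ?_) hy
    rw [Real.dist_eq, sub_zero, abs_of_nonneg h0]
    exact h1.trans_lt ((le_abs_self t).trans_lt ht)

variable {X : Type*} [NormedAddCommGroup X] [NormedSpace ℝ X]

lemma mvt {Φ : X → ℝ} (hC1 : ContDiff ℝ 1 Φ) {w v : X} {t σ : ℝ} (ht : 0 ≤ t)
    (h : ∀ τ, 0 ≤ τ → τ ≤ t → fderiv ℝ Φ (w + τ • v) v < -σ) : Φ (w + t • v) ≤ Φ w - σ * t := by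
  have hd : ∀ τ : ℝ, HasDerivAt (fun τ : ℝ => Φ (w + τ • v)) (fderiv ℝ Φ (w + τ • v) v) τ := by
    intro τ
    have h1 : HasFDerivAt Φ (fderiv ℝ Φ (w + τ • v)) (w + τ • v) :=
      ((hC1.differentiable one_ne_zero) _).hasFDerivAt
    have h2 : HasDerivAt (fun τ : ℝ => w + τ • v) v τ := by
      simpa using ((hasDerivAt_id τ).smul_const v).const_add w
    exact h1.comp_hasDerivAt τ h2
  have := (convex_Icc (0:ℝ) t).image_sub_le_mul_sub_of_deriv_le (f := fun τ : ℝ => Φ (w + τ • v)) (C := -σ)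
    (fun τ _ => (hd τ).continuousAt.continuousWithinAt)
    (fun τ _ => (hd τ).differentiableAt.differentiableWithinAt)
    (fun τ hτ => by
      rw [interior_Icc] at hτ
      rw [(hd τ).deriv]
      exact (h τ hτ.1.le hτ.2.le).le) 0 ⟨le_rfl, ht⟩ t ⟨ht, le_rfl⟩ ht
  simp at this
  linarith

lemma fderiv_even {Φ : X → ℝ} (hC1 : ContDiff ℝ 1 Φ) (heven : ∀ u, Φ (-u) = Φ u) (u : X) :
    fderiv ℝ Φ (-u) = - fderiv ℝ Φ u := by
  have hd : ∀ w, HasFDerivAt Φ (fderiv ℝ Φ w) w := fun w =>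
    ((hC1.differentiable one_ne_zero) w).hasFDerivAt
  have h1 : (fun x => Φ (-x)) = Φ := funext heven
  have h2 : HasFDerivAt (fun x : X => Φ (-x)) ((fderiv ℝ Φ (-u)).comp (-ContinuousLinearMap.id ℝ X)) u :=
    (hd (-u)).comp u (hasFDerivAt_id u).neg
  rw [h1] at h2
  have h3 := (hd u).unique h2
  rw [h3]
  ext v
  simp

theorem deform [CompleteSpace X] {Φ : X → ℝ} (hC1 : ContDiff ℝ 1 Φ) (heven : ∀ u, Φ (-u) = Φ u)
    {m0 : ℝ} (hm0 : ∀ u, m0 ≤ Φ u) {A : Set X} (hA : IsCompact A) (hAs : ∀ x ∈ A, -x ∈ A)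
    {θ : X → ℝ} (hθe : ∀ u, θ (-u) = θ u) {κ : ℝ} (hθL : ∀ x y, θ x ≤ θ y + κ * ‖x - y‖)
    (hκ : 0 ≤ κ) (hθc : Continuous θ)
    {Z : Set X} (hZo : IsOpen Z) (hZs : ∀ u ∈ Z, -u ∈ Z) (hZθ : ∀ u ∈ Z, θ u = 0)
    {a b σ : ℝ} (hσ : 0 < σ) (hAb : ∀ x ∈ A, Φ x + θ x ≤ b)
    (H : ∀ u, Φ u + θ u ≤ b → a ≤ Φ u → ∃ v, ‖v‖ ≤ 1 ∧ fderiv ℝ Φ u v < -σ ∧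
      (u ∈ Z ∨ fderiv ℝ Φ u v < -κ)) :
    ∃ h : C(A, X), (∀ x y : A, (y : X) = -x → h y = - h x) ∧ ∀ x, Φ (h x) ≤ a := by
  classical
  haveI : CompactSpace A := isCompact_iff_compactSpace.1 hA
  have hΦc : Continuous Φ := hC1.continuous
  have hDc : Continuous (fderiv ℝ Φ) := hC1.continuous_fderiv one_ne_zero
  by_contra hcon
  push Not at hcon
  let ng : A → A := fun x => ⟨-x, hAs x x.2⟩
  have hng : Continuous ng := by fun_prop
  let Es : Set C(A, X) := {h | (∀ x, h (ng x) = - h x) ∧ ∀ x, Φ (h x) + θ (h x) ≤ b}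
  have hEs : IsClosed Es := by
    have : Es = (⋂ x, {h : C(A, X) | h (ng x) = - h x}) ∩ ⋂ x, {h : C(A, X) | Φ (h x) + θ (h x) ≤ b} := by
      ext h; simp [Es]
    rw [this]
    refine IsClosed.inter (isClosed_iInter fun x => ?_) (isClosed_iInter fun x => ?_)
    · exact isClosed_eq (continuous_eval_const _) (continuous_eval_const _).neg
    · have := continuous_eval_const (F := C(A, X)) x
      exact isClosed_le ((hΦc.comp this).add (hθc.comp this)) continuous_const
  haveI : CompleteSpace Es := hEs.completeSpace_coe
  let i0 : Es := ⟨⟨Subtype.val, continuous_subtype_val⟩, fun x => rfl, fun x => hAb x x.2⟩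
  haveI : Nonempty Es := ⟨i0⟩
  have hcon' : ∀ h : Es, ∃ x, a < Φ (h.1 x) := by
    intro h
    refine hcon h.1 ?_
    intro x y hxy
    have : y = ng x := Subtype.ext hxy
    rw [this]; exact h.2.1 x
  obtain ⟨x00, -⟩ := hcon' i0
  let F : Es → ℝ := fun h => sSup ((fun x => Φ (h.1 x)) '' Set.univ)
  have hFc : Continuous F := by
    apply IsCompact.continuous_sSup isCompact_univ
    have : Continuous (fun z : Es × A => z.1.1 z.2) := by fun_prop
    exact hΦc.comp this
  have hbdd : ∀ h : Es, BddAbove ((fun x => Φ (h.1 x)) '' Set.univ) := fun h =>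
    (isCompact_univ.image (hΦc.comp h.1.continuous)).bddAbove
  have hleF : ∀ (h : Es) x, Φ (h.1 x) ≤ F h := fun h x => le_csSup (hbdd h) ⟨x, trivial, rfl⟩
  refine caristi F hFc m0 (fun h => (hm0 _).trans (hleF h x00)) σ hσ ?_
  rintro ⟨h, hodd, hcons⟩
  set M := F ⟨h, hodd, hcons⟩ with hM
  have hMx : ∀ x, Φ (h x) ≤ M := hleF ⟨h, hodd, hcons⟩
  have haM : a < M := by
    obtain ⟨x, hx⟩ := hcon' ⟨h, hodd, hcons⟩
    exact hx.trans_le (hMx x)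
  have hhc : Continuous h := h.continuous
  let t : A → Set X := fun x => {v | ‖v‖ ≤ 1 ∧ (a ≤ Φ (h x) → fderiv ℝ Φ (h x) v < -σ ∧
    (h x ∈ Z ∨ fderiv ℝ Φ (h x) v < -κ))}
  have hlin : ∀ (f : X →L[ℝ] ℝ) (r : ℝ), Convex ℝ {v | f v < r} := fun f r =>
    convex_halfSpace_lt f.toLinearMap.isLinear r
  have htconv : ∀ x, Convex ℝ (t x) := by
    intro x u hu v hv p q hp hq hpq
    refine ⟨?_, fun hax => ⟨?_, ?_⟩⟩
    · have := convex_closedBall (0 : X) 1 (x := u) (by simpa using hu.1) (y := v) (by simpa using hv.1) hp hq hpq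
      simpa using this
    · exact hlin (fderiv ℝ Φ (h x)) (-σ) (hu.2 hax).1 (hv.2 hax).1 hp hq hpq
    · rcases (hu.2 hax).2 with h1 | h1
      · exact Or.inl h1
      rcases (hv.2 hax).2 with h2 | h2
      · exact Or.inl h2
      · exact Or.inr (hlin (fderiv ℝ Φ (h x)) (-κ) h1 h2 hp hq hpq)
  have hevlt : ∀ (v : X) (r : ℝ) (x : A), fderiv ℝ Φ (h x) v < r → ∀ᶠ y in 𝓝 x, fderiv ℝ Φ (h y) v < r := by
    intro v r x hx
    have : Continuous (fun y => fderiv ℝ Φ (h y) v) := by fun_prop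
    exact this.continuousAt.eventually (gt_mem_nhds hx)
  obtain ⟨g0, hg0⟩ := exists_continuous_forall_mem_convex_of_local_const htconv (by
    intro x
    by_cases hax : a ≤ Φ (h x)
    · obtain ⟨v, hv1, hv2, hv3⟩ := H (h x) (hcons x) hax
      refine ⟨v, ?_⟩
      have e1 := hevlt v _ x hv2
      have e2 : ∀ᶠ y in 𝓝 x, (h y ∈ Z ∨ fderiv ℝ Φ (h y) v < -κ) := by
        rcases hv3 with h3 | h3
        · exact (hhc.continuousAt.eventually (hZo.mem_nhds h3)).mono fun y hy => Or.inl hy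
        · exact (hevlt v _ x h3).mono fun y hy => Or.inr hy
      filter_upwards [e1, e2] with y h1 h2
      exact ⟨hv1, fun _ => ⟨h1, h2⟩⟩
    · push Not at hax
      refine ⟨0, ?_⟩
      have : ∀ᶠ y in 𝓝 x, Φ (h y) < a := (hΦc.comp hhc).continuousAt.eventually (gt_mem_nhds hax)
      filter_upwards [this] with y hy
      exact ⟨by simp, fun h' => absurd h' (not_le.2 hy)⟩)
  have htneg : ∀ x v, v ∈ t (ng x) → -v ∈ t x := by
    intro x v hv
    have hv1 : ‖v‖ ≤ 1 := hv.1
    refine ⟨by simpa using hv1, fun hax => ?_⟩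
    have := hv.2 (by rw [hodd, heven]; exact hax)
    rw [hodd, fderiv_even hC1 heven] at this
    simp only [neg_apply] at this
    rw [map_neg]
    refine ⟨this.1, ?_⟩
    rcases this.2 with h1 | h1
    · left; simpa using hZs _ h1
    · exact Or.inr h1
  let g : A → X := fun x => (1/2 : ℝ) • g0 x + (1/2 : ℝ) • (- g0 (ng x))
  have hgc : Continuous g := by fun_prop
  have hgt : ∀ x, g x ∈ t x := fun x =>
    htconv x (hg0 x) (htneg x _ (hg0 (ng x))) (by norm_num) (by norm_num) (by norm_num)
  have hgodd : ∀ x, g (ng x) = - g x := by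
    intro x
    have : ng (ng x) = x := Subtype.ext (neg_neg _)
    simp only [g, this]
    module
  -- uniform small times
  have hA' : IsCompact {x : A | a ≤ Φ (h x)} :=
    (isClosed_le continuous_const (hΦc.comp hhc)).isCompact
  have hunif : ∀ᶠ s in 𝓝 (0 : ℝ), ∀ x ∈ {x : A | a ≤ Φ (h x)}, 0 ≤ s →
      (Φ (h x + s • g x) ≤ Φ (h x) - σ * s ∧
        Φ (h x + s • g x) + θ (h x + s • g x) ≤ Φ (h x) + θ (h x)) := by
    apply hA'.eventually_forall_of_forall_eventually
    intro y hy
    have hjc : Continuous (fun z : ℝ × A => h z.2 + z.1 • g z.2) := by fun_prop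
    have hjd : Continuous (fun z : ℝ × A => fderiv ℝ Φ (h z.2 + z.1 • g z.2) (g z.2)) := by fun_prop
    have hev : ∀ r, fderiv ℝ Φ (h y) (g y) < -r →
        ∀ᶠ z : ℝ × A in 𝓝 (0, y), 0 ≤ z.1 → Φ (h z.2 + z.1 • g z.2) ≤ Φ (h z.2) - r * z.1 := by
      intro r hr
      have h1 : ∀ᶠ z : ℝ × A in 𝓝 (0, y), fderiv ℝ Φ (h z.2 + z.1 • g z.2) (g z.2) < -r :=
        hjd.continuousAt.eventually (gt_mem_nhds (by simpa using hr))
      have h2 := eventually_segment (p := fun s x => fderiv ℝ Φ (h x + s • g x) (g x) < -r) h1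
      filter_upwards [h2] with z hz hz0
      exact mvt hC1 hz0 hz
    obtain ⟨hy1, hy2⟩ := (hgt y).2 hy
    have e1 := hev σ hy1
    have e2 : ∀ᶠ z : ℝ × A in 𝓝 (0, y), 0 ≤ z.1 → Φ (h z.2 + z.1 • g z.2) + θ (h z.2 + z.1 • g z.2) ≤
        Φ (h z.2) + θ (h z.2) := by
      rcases hy2 with h3 | h3
      · have f1 : ∀ᶠ z : ℝ × A in 𝓝 (0, y), h z.2 + z.1 • g z.2 ∈ Z :=
          hjc.continuousAt.eventually (hZo.mem_nhds (by simpa using h3))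
        have f2 : ∀ᶠ z : ℝ × A in 𝓝 (0, y), h z.2 ∈ Z :=
          (hhc.comp continuous_snd).continuousAt.eventually (hZo.mem_nhds h3)
        filter_upwards [e1, f1, f2] with z hz1 hz2 hz3 hz0
        rw [hZθ _ hz2, hZθ _ hz3]
        have := hz1 hz0
        nlinarith
      · filter_upwards [hev κ h3] with z hz hz0
        have h5 := hθL (h z.2 + z.1 • g z.2) (h z.2)
        rw [add_sub_cancel_left, norm_smul, Real.norm_of_nonneg hz0] at h5
        have h6 : ‖g z.2‖ ≤ 1 := (hgt z.2).1
        have h7 : κ * (z.1 * ‖g z.2‖) ≤ κ * z.1 :=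
          mul_le_mul_of_nonneg_left (mul_le_of_le_one_right hz0 h6) hκ
        linarith [hz hz0]
    filter_upwards [e1, e2] with z h1 h2 hz0
    exact ⟨h1 hz0, h2 hz0⟩
  rw [Metric.eventually_nhds_iff] at hunif
  obtain ⟨r, hr, hunif⟩ := hunif
  have hMa : 0 < M - a := sub_pos.2 haM
  let s : ℝ := min (r / 2) ((M - a) / σ)
  have hs0 : 0 < s := lt_min (by positivity) (by positivity)
  have hsr : s < r := (min_le_left _ _).trans_lt (by linarith)
  have hsM : σ * s ≤ M - a := by
    have : s ≤ (M - a) / σ := min_le_right _ _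
    rw [le_div_iff₀ hσ] at this; linarith
  let χ : A → ℝ := fun x => max 0 (Φ (h x) - a) / (M - a)
  have hχc : Continuous χ := by
    have := hΦc.comp hhc
    exact (continuous_const.max (this.sub continuous_const)).div_const _
  have hχ0 : ∀ x, 0 ≤ χ x := fun x => div_nonneg (le_max_left _ _) hMa.le
  have hχ1 : ∀ x, χ x ≤ 1 := fun x => by
    rw [div_le_one hMa]; exact max_le hMa.le (by linarith [hMx x])
  have hχe : ∀ x, χ (ng x) = χ x := fun x => by simp only [χ, hodd, heven]
  let h' : C(A, X) := ⟨fun x => h x + (s * χ x) • g x, by fun_prop⟩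
  have hh' : ∀ x, h' x = h x + (s * χ x) • g x := fun x => rfl
  have hmain : ∀ x, Φ (h' x) ≤ M - σ * s ∧ Φ (h' x) + θ (h' x) ≤ Φ (h x) + θ (h x) := by
    intro x
    rw [hh']
    by_cases hax : a ≤ Φ (h x)
    · have hsx : s * χ x ≤ s := mul_le_of_le_one_right hs0.le (hχ1 x)
      have hsx0 : 0 ≤ s * χ x := mul_nonneg hs0.le (hχ0 x)
      obtain ⟨k1, k2⟩ := hunif (y := s * χ x) (by
        rw [Real.dist_eq, sub_zero, abs_of_nonneg hsx0]; linarith) x hax hsx0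
      refine ⟨k1.trans ?_, k2⟩
      have hχx : χ x * (M - a) = Φ (h x) - a := by
        simp only [χ]
        rw [max_eq_right (by linarith), div_mul_cancel₀ _ hMa.ne']
      have h1 := hχ1 x
      nlinarith
    · push Not at hax
      have : χ x = 0 := by simp only [χ]; rw [max_eq_left (by linarith), zero_div]
      simp only [this, mul_zero, zero_smul, add_zero]
      exact ⟨by linarith, le_rfl⟩
  let hE' : Es := ⟨h', fun x => by
    rw [hh', hh', hodd, hgodd, hχe]; module, fun x => (hmain x).2.trans (hcons x)⟩
  have hF' : F hE' ≤ M - σ * s := by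
    show sSup ((fun x => Φ (h' x)) '' Set.univ) ≤ M - σ * s
    refine csSup_le (Set.Nonempty.image _ ⟨x00, trivial⟩) ?_
    rintro _ ⟨x, -, rfl⟩
    exact (hmain x).1
  refine ⟨hE', ?_, ?_⟩
  · intro heq
    have : F hE' = M := by rw [heq]
    nlinarith
  · have hd : dist (⟨h, hodd, hcons⟩ : Es) hE' ≤ s := by
      rw [Subtype.dist_eq, ContinuousMap.dist_le hs0.le]
      intro x
      show dist (h x) (h' x) ≤ s
      rw [hh', dist_self_add_right, norm_smul, Real.norm_of_nonneg (mul_nonneg hs0.le (hχ0 x))]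
      have h6 : ‖g x‖ ≤ 1 := (hgt x).1
      have h8 := hχ1 x
      have h9 := hχ0 x
      calc s * χ x * ‖g x‖ ≤ s * χ x * 1 := mul_le_mul_of_nonneg_left h6 (mul_nonneg hs0.le h9)
        _ ≤ s := by nlinarith
    nlinarith

end Deform
end ClarkExt
namespace ClarkExt

section Final

variable {X : Type*} [NormedAddCommGroup X] [NormedSpace ℝ X]

def PSC (Φ : X → ℝ) : Prop := ∀ u : ℕ → X, (∃ M : ℝ, ∀ n, |Φ (u n)| ≤ M) →
      Tendsto (fun n => ‖fderiv ℝ Φ (u n)‖) atTop (𝓝 0) →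
      ∃ σ : ℕ → ℕ, StrictMono σ ∧ ∃ x : X, Tendsto (u ∘ σ) atTop (𝓝 x)

lemma ps_seq {Φ : X → ℝ} (hC1 : ContDiff ℝ 1 Φ) (hPS : PSC Φ) {D : Set X} (hD : IsClosed D)
    (u : ℕ → X) (hu : ∀ n, u n ∈ D) (hb : ∃ M : ℝ, ∀ n, |Φ (u n)| ≤ M)
    (ht : Tendsto (fun n => ‖fderiv ℝ Φ (u n)‖) atTop (𝓝 0)) :
    ∃ σ : ℕ → ℕ, StrictMono σ ∧ ∃ x ∈ D, Tendsto (u ∘ σ) atTop (𝓝 x) ∧ fderiv ℝ Φ x = 0 ∧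
      Tendsto (fun n => Φ (u (σ n))) atTop (𝓝 (Φ x)) := by
  obtain ⟨σ, hσ, x, hx⟩ := hPS u hb ht
  refine ⟨σ, hσ, x, hD.mem_of_tendsto hx (Eventually.of_forall fun n => hu _), hx, ?_,
    (hC1.continuous.tendsto x).comp hx⟩
  have hDc : Continuous (fun x => ‖fderiv ℝ Φ x‖) := (hC1.continuous_fderiv one_ne_zero).norm
  have h1 := (hDc.tendsto x).comp hx
  have h2 := ht.comp hσ.tendsto_atTop
  exact norm_eq_zero.1 (tendsto_nhds_unique h1 h2)

lemma ps_level {Φ : X → ℝ} (hC1 : ContDiff ℝ 1 Φ) (hPS : PSC Φ) {D : Set X} (hD : IsClosed D)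
    (c : ℝ) (hn : ∀ u ∈ D, fderiv ℝ Φ u = 0 → Φ u ≠ c) :
    ∃ ε > 0, ∀ u ∈ D, |Φ u - c| ≤ ε → ε ≤ ‖fderiv ℝ Φ u‖ := by
  by_contra hcon
  push Not at hcon
  choose u hu1 hu2 hu3 using fun n : ℕ => hcon (1 / ((n : ℝ) + 1)) (by positivity)
  have hz := tendsto_one_div_add_atTop_nhds_zero_nat (𝕜 := ℝ)
  have hle : ∀ n : ℕ, 1 / ((n : ℝ) + 1) ≤ 1 := fun n => by
    rw [div_le_one (by positivity)]; linarith [Nat.cast_nonneg (α := ℝ) n]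
  obtain ⟨σ, hσ, x, hxD, hx, hx0, hxΦ⟩ := ps_seq hC1 hPS hD u hu1
    ⟨|c| + 1, fun n => by
      have := abs_add_le (Φ (u n) - c) c
      rw [sub_add_cancel] at this
      linarith [hu2 n, hle n]⟩
    (squeeze_zero (fun n => norm_nonneg _) (fun n => (hu3 n).le) hz)
  refine hn x hxD hx0 ?_
  have h1 : Tendsto (fun n => Φ (u n) - c) atTop (𝓝 0) := by
    rw [tendsto_zero_iff_abs_tendsto_zero]
    exact squeeze_zero (fun n => abs_nonneg _) hu2 hz
  have h2 := h1.comp hσ.tendsto_atTop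
  have h3 := tendsto_nhds_unique h2 (hxΦ.sub_const c)
  linarith

lemma ps_bdd {Φ : X → ℝ} (hC1 : ContDiff ℝ 1 Φ) (hPS : PSC Φ) {D : Set X} (hD : IsClosed D)
    (M : ℝ) (hM : ∀ u ∈ D, |Φ u| ≤ M) (hn : ∀ u ∈ D, fderiv ℝ Φ u ≠ 0) :
    ∃ σ > 0, ∀ u ∈ D, σ ≤ ‖fderiv ℝ Φ u‖ := by
  by_contra hcon
  push Not at hcon
  choose u hu1 hu3 using fun n : ℕ => hcon (1 / ((n : ℝ) + 1)) (by positivity)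
  have hz := tendsto_one_div_add_atTop_nhds_zero_nat (𝕜 := ℝ)
  obtain ⟨σ, hσ, x, hxD, hx, hx0, hxΦ⟩ := ps_seq hC1 hPS hD u hu1 ⟨M, fun n => hM _ (hu1 n)⟩
    (squeeze_zero (fun n => norm_nonneg _) (fun n => (hu3 n).le) hz)
  exact hn x hxD hx0

lemma crit_closed {Φ : X → ℝ} (hC1 : ContDiff ℝ 1 Φ) {D : Set X} (hD : IsClosed D) (c : ℝ) :
    IsClosed {u | u ∈ D ∧ fderiv ℝ Φ u = 0 ∧ Φ u = c} :=
  hD.inter ((isClosed_eq (hC1.continuous_fderiv one_ne_zero) continuous_const).inter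
    (isClosed_eq hC1.continuous continuous_const))

lemma crit_compact {Φ : X → ℝ} (hC1 : ContDiff ℝ 1 Φ) (hPS : PSC Φ) {D : Set X} (hD : IsClosed D)
    (c : ℝ) : IsCompact {u | u ∈ D ∧ fderiv ℝ Φ u = 0 ∧ Φ u = c} := by
  apply IsSeqCompact.isCompact
  intro u hu
  obtain ⟨σ, hσ, x, hxD, hx, hx0, hxΦ⟩ := ps_seq hC1 hPS (crit_closed hC1 hD c) u hu
    ⟨|c|, fun n => by rw [(hu n).2.2]⟩ (by
      have : (fun n => ‖fderiv ℝ Φ (u n)‖) = fun _ => 0 := by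
        funext n; rw [(hu n).2.1, norm_zero]
      rw [this]; exact tendsto_const_nhds)
  exact ⟨x, hxD, σ, hσ, hx⟩

lemma gen_pullback {A : Set X} {n : ℕ} (hA : IsCompact A) (hAs : ∀ x ∈ A, -x ∈ A) (h : C(A, X))
    (hodd : ∀ x y : A, (y : X) = -x → h y = - h x) (hg : Gen (Set.range h) n) : Gen A n := by
  obtain ⟨F, hF1, hF2, hF3⟩ := hg
  refine ⟨fun i => Subtype.val '' (h ⁻¹' F i), fun i => ?_, ?_, ?_⟩
  · exact hA.isClosed.isClosedEmbedding_subtypeVal.isClosedMap _ ((hF1 i).preimage h.continuous)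
  · rintro i _ ⟨x, hx, rfl⟩ ⟨y, hy, hyx⟩
    rw [Set.mem_preimage, hodd x y hyx] at hy
    exact hF2 i _ hx hy
  · intro x hx
    obtain ⟨i, hi⟩ := hF3 (h ⟨x, hx⟩) ⟨_, rfl⟩
    refine ⟨i, ?_⟩
    rcases hi with hi | hi
    · exact Or.inl ⟨⟨x, hx⟩, hi, rfl⟩
    · right
      refine ⟨⟨-x, hAs x hx⟩, ?_, rfl⟩
      rw [Set.mem_preimage, hodd ⟨x, hx⟩ ⟨-x, hAs x hx⟩ rfl]
      exact hi

lemma exists_d {K C : Set X} (hK : IsCompact K) (hKs : ∀ x ∈ K, -x ∈ K) (h0 : (0 : X) ∉ K)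
    (hC : IsClosed C) (hKC : Disjoint K C) :
    ∃ (d : X → ℝ) (ρ : ℝ) (m : ℕ), 0 < ρ ∧ (∀ x y, d x ≤ d y + ‖x - y‖) ∧ (∀ x, d (-x) = d x) ∧
      Continuous d ∧ Gen {u | d u ≤ ρ} m ∧ (∀ u, ρ / 2 ≤ d u → u ∉ K) ∧ (∀ u, d u ≤ ρ → u ∉ C) := by
  classical
  rcases K.eq_empty_or_nonempty with rfl | hne
  · refine ⟨fun _ => 2, 1, 0, one_pos, fun x y => ?_, fun _ => rfl, continuous_const, ?_,
      fun u _ => id, fun u hu => ?_⟩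
    · linarith [norm_nonneg (x - y)]
    · refine ⟨fun _ => ∅, fun i => isClosed_empty, fun i x hx => hx.elim, fun x hx => ?_⟩
      have : (2 : ℝ) ≤ 1 := hx
      linarith
    · norm_num at hu
  obtain ⟨t, htK, htc⟩ := hK.elim_nhds_subcover (fun x => Metric.ball x (‖x‖ / 4)) (fun x hx =>
    Metric.ball_mem_nhds _ (by
      have : x ≠ 0 := fun h => h0 (h ▸ hx)
      have := norm_pos_iff.2 this
      positivity))
  have hUo : IsOpen ((⋃ x ∈ t, Metric.ball x (‖x‖ / 4)) ∩ Cᶜ) :=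
    (isOpen_biUnion fun x _ => Metric.isOpen_ball).inter hC.isOpen_compl
  obtain ⟨δ, hδ, hδU⟩ := hK.exists_thickening_subset_open hUo
    (Set.subset_inter htc hKC.subset_compl_right)
  have hU : ∀ u, Metric.infDist u K ≤ δ / 2 → u ∈ (⋃ x ∈ t, Metric.ball x (‖x‖ / 4)) ∩ Cᶜ := by
    intro u hu
    apply hδU
    obtain ⟨y, hy, hyd⟩ := hK.exists_infDist_eq_dist hne u
    rw [Metric.mem_thickening_iff]
    exact ⟨y, hy, by linarith⟩
  have hle : ∀ x, Metric.infDist (-x) K ≤ Metric.infDist x K := by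
    intro x
    obtain ⟨y, hy, hyd⟩ := hK.exists_infDist_eq_dist hne x
    rw [hyd, ← dist_neg_neg x y]
    exact Metric.infDist_le_dist_of_mem (hKs y hy)
  refine ⟨fun u => Metric.infDist u K, δ / 2, t.card, by positivity, fun x y => ?_, fun x => ?_,
    Metric.continuous_infDist_pt K, ?_, fun u hu huK => ?_, fun u hu => (hU u hu).2⟩
  · rw [← dist_eq_norm]; exact Metric.infDist_le_infDist_add_dist
  · exact le_antisymm (hle x) (by simpa using hle (-x))
  · refine ⟨fun i => Metric.closedBall ((t.equivFin.symm i : t) : X) (‖((t.equivFin.symm i : t) : X)‖ / 4),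
      fun i => Metric.isClosed_closedBall, fun i x hx hx' => ?_, fun x hx => ?_⟩
    · set y : X := ((t.equivFin.symm i : t) : X) with hy
      have hyK : y ∈ K := htK _ (t.equivFin.symm i).2
      have hy0 : 0 < ‖y‖ := norm_pos_iff.2 fun h => h0 (h ▸ hyK)
      rw [Metric.mem_closedBall, dist_eq_norm] at hx hx'
      have h1 : (2 : ℝ) • y = -((x - y) + (-x - y)) := by module
      have h2 : ‖(2 : ℝ) • y‖ ≤ ‖x - y‖ + ‖-x - y‖ := by
        rw [h1, norm_neg]; exact norm_add_le _ _
      rw [norm_smul, Real.norm_of_nonneg (by norm_num)] at h2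
      linarith
    · have := (hU x hx).1
      simp only [Set.mem_iUnion] at this
      obtain ⟨y, hyt, hxy⟩ := this
      refine ⟨t.equivFin ⟨y, hyt⟩, Or.inl ?_⟩
      simp only [Equiv.symm_apply_apply]
      exact Metric.ball_subset_closedBall hxy
  · have hu' : δ / 2 / 2 ≤ Metric.infDist u K := hu
    rw [Metric.infDist_zero_of_mem huK] at hu'
    linarith

def Bd (Φ : X → ℝ) (b : ℝ) (n : ℕ) : Prop :=
  ∀ A : Set X, IsCompact A → (∀ x ∈ A, -x ∈ A) → (∀ x ∈ A, Φ x ≤ b) → Gen A n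

lemma exists_dir (f : X →L[ℝ] ℝ) (hf : 0 < ‖f‖) : ∃ v, ‖v‖ ≤ 1 ∧ f v < -(‖f‖ / 2) := by
  obtain ⟨x, hx1, hx2⟩ := f.exists_lt_apply_of_lt_opNorm (r := ‖f‖ / 2) (by linarith)
  rcases le_total 0 (f x) with h | h
  · refine ⟨-x, by simpa using hx1.le, ?_⟩
    rw [Real.norm_of_nonneg h] at hx2
    rw [map_neg]; linarith
  · refine ⟨x, hx1.le, ?_⟩
    rw [Real.norm_of_nonpos h] at hx2
    linarith

lemma claim [CompleteSpace X] {Φ : X → ℝ} (hC1 : ContDiff ℝ 1 Φ) (heven : ∀ u, Φ (-u) = Φ u)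
    (hPS : PSC Φ) {m0 : ℝ} (hm0 : ∀ u, m0 ≤ Φ u) {a : ℝ} (ha : 0 < a)
    (N1 : ∀ u, fderiv ℝ Φ u = 0 → Φ u < 0 → a < ‖u‖)
    (N2 : ∀ u, fderiv ℝ Φ u = 0 → Φ u ≤ 0 → ‖u‖ ≠ a) {c : ℝ} (hc : c ≤ 0) :
    ∃ ε > 0, ∃ m : ℕ, ∀ n, Bd Φ (c - ε) n → ∀ b < 0, b ≤ c + ε → Bd Φ b (n + m) := by
  have hΦc := hC1.continuous
  have hDout : IsClosed {u : X | a ≤ ‖u‖} := isClosed_le continuous_const continuous_norm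
  have hDin : IsClosed {u : X | ‖u‖ ≤ a} := isClosed_le continuous_norm continuous_const
  obtain ⟨d, ρ, m, hρ, hdL, hde, hdc, hdG, hdK, hdC⟩ := exists_d
    (crit_compact hC1 hPS hDout c) (by
      rintro x ⟨h1, h2, h3⟩
      refine ⟨?_, ?_, ?_⟩
      · show a ≤ ‖-x‖
        rw [norm_neg]; exact h1
      · rw [fderiv_even hC1 heven, h2, neg_zero]
      · rw [heven, h3]) (by
      rintro ⟨h1, -⟩
      have : a ≤ ‖(0 : X)‖ := h1
      rw [norm_zero] at this; linarith) (crit_closed hC1 hDin c) (by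
      rw [Set.disjoint_left]
      rintro x ⟨h1, h2, h3⟩ ⟨h4, -⟩
      exact N2 x h2 (by rw [h3]; exact hc) (le_antisymm h4 h1))
  have hD0 : IsClosed {u : X | ρ / 2 ≤ d u ∧ d u ≤ ρ} :=
    (isClosed_le continuous_const hdc).inter (isClosed_le hdc continuous_const)
  have hD2 : IsClosed {u : X | ρ / 2 ≤ d u ∧ a ≤ ‖u‖} :=
    (isClosed_le continuous_const hdc).inter hDout
  obtain ⟨ε0, hε0, hE0⟩ := ps_level hC1 hPS hD0 c (by
    rintro u ⟨h1, h2⟩ h3 h4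
    rcases le_total a ‖u‖ with h | h
    · exact hdK u h1 ⟨h, h3, h4⟩
    · exact hdC u h2 ⟨h, h3, h4⟩)
  obtain ⟨ε2, hε2, hE2⟩ := ps_level hC1 hPS hD2 c (by
    rintro u ⟨h1, h2⟩ h3 h4
    exact hdK u h1 ⟨h2, h3, h4⟩)
  obtain ⟨ε, hε, e0, e2, e3⟩ : ∃ ε > 0, ε ≤ ε0 ∧ ε ≤ ε2 ∧ ε ≤ ε0 / 2 * ρ / 8 :=
    ⟨min ε0 (min ε2 (ε0 / 2 * ρ / 8)), lt_min hε0 (lt_min hε2 (by positivity)), min_le_left _ _,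
      (min_le_right _ _).trans (min_le_left _ _), (min_le_right _ _).trans (min_le_right _ _)⟩
  refine ⟨ε, hε, m, fun n hBd b hb hbc A hA hAs hAb => ?_⟩
  have hD1 : IsClosed {u : X | ρ / 2 ≤ d u ∧ c - ε ≤ Φ u ∧ Φ u ≤ b} :=
    (isClosed_le continuous_const hdc).inter
      ((isClosed_le continuous_const hΦc).inter (isClosed_le hΦc continuous_const))
  obtain ⟨σ0, hσ0, hS0⟩ := ps_bdd hC1 hPS hD1 (|c| + ε) (by
    rintro u ⟨h1, h2, h3⟩
    have := neg_abs_le c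
    have := le_abs_self c
    rw [abs_le]; constructor <;> linarith) (by
    rintro u ⟨h1, h2, h3⟩ h4
    have h5 := N1 u h4 (by linarith)
    have h6 := hE2 u ⟨h1, h5.le⟩ (by rw [abs_le]; constructor <;> linarith)
    rw [h4, norm_zero] at h6
    linarith)
  let κ : ℝ := ε0 / 2
  have hκ : 0 < κ := by positivity
  let θ : X → ℝ := fun u => κ * max 0 (ρ - d u)
  have hθ0 : ∀ u, 0 ≤ θ u := fun u => mul_nonneg hκ.le (le_max_left _ _)
  have hθz : ∀ u, ρ ≤ d u → θ u = 0 := fun u hu => by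
    simp only [θ]; rw [max_eq_left (by linarith), mul_zero]
  have hA0c : IsCompact (A ∩ {u | ρ ≤ d u}) := hA.inter_right (isClosed_le continuous_const hdc)
  have hA0s : ∀ x ∈ A ∩ {u | ρ ≤ d u}, -x ∈ A ∩ {u | ρ ≤ d u} := by
    rintro x ⟨h1, h2⟩
    refine ⟨hAs x h1, ?_⟩
    show ρ ≤ d (-x)
    rw [hde]; exact h2
  obtain ⟨h, hodd, hle⟩ := deform (a := c - ε) (b := b) (σ := σ0 / 2) (κ := κ) (θ := θ)
    (Z := {u | ρ < d u}) hC1 heven hm0 hA0c hA0s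
    (fun u => by simp only [θ, hde]) (fun x y => by
      have h1 : max 0 (ρ - d x) ≤ max 0 (ρ - d y) + ‖x - y‖ := by
        apply max_le
        · exact add_nonneg (le_max_left _ _) (norm_nonneg _)
        · have := hdL y x
          rw [norm_sub_rev] at this
          linarith [le_max_right 0 (ρ - d y)]
      simp only [θ]
      rw [← mul_add]
      exact mul_le_mul_of_nonneg_left h1 hκ.le) hκ.le
    (continuous_const.mul (continuous_const.max (continuous_const.sub hdc)))
    (isOpen_lt continuous_const hdc) (fun u hu => by
      show ρ < d (-u)
      rw [hde]; exact hu) (fun u hu => hθz u (le_of_lt hu)) (by positivity)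
    (fun x hx => by rw [hθz x hx.2, add_zero]; exact hAb x hx.1) (by
      intro u hu1 hu2
      have t0 := hθ0 u
      have t1 : κ * max 0 (ρ - d u) ≤ κ * (ρ / 4) := by
        have : θ u ≤ κ * (ρ / 4) := by
          have : κ * (ρ / 4) = 2 * (ε0 / 2 * ρ / 8) := by simp only [κ]; ring
          rw [this]; linarith
        exact this
      have t2 := le_of_mul_le_mul_left t1 hκ
      have t3 : ρ / 2 ≤ d u := by linarith [le_max_right 0 (ρ - d u)]
      have t4 := hS0 u ⟨t3, hu2, by linarith⟩
      obtain ⟨v, hv1, hv2⟩ := exists_dir (fderiv ℝ Φ u) (by linarith)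
      refine ⟨v, hv1, by linarith, ?_⟩
      rcases lt_or_ge ρ (d u) with h | h
      · exact Or.inl h
      · right
        have := hE0 u ⟨t3, h⟩ (by rw [abs_le]; constructor <;> linarith)
        simp only [κ]
        linarith)
  have hGA0 : Gen (A ∩ {u | ρ ≤ d u}) n := by
    refine gen_pullback hA0c hA0s h hodd (hBd _ ?_ ?_ ?_)
    · have : CompactSpace ↥(A ∩ {u | ρ ≤ d u}) := isCompact_iff_compactSpace.1 hA0c
      exact isCompact_range h.continuous
    · rintro _ ⟨x, rfl⟩
      exact ⟨⟨-x, hA0s x x.2⟩, hodd x _ rfl⟩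
    · rintro _ ⟨x, rfl⟩
      exact hle x
  refine (hGA0.union hdG).mono ?_
  intro x hx
  rcases le_total ρ (d x) with h | h
  · exact Or.inl ⟨hx, h⟩
  · exact Or.inr h

lemma bd_mono {Φ : X → ℝ} {b b' : ℝ} {n : ℕ} (h : Bd Φ b n) (hb : b' ≤ b) : Bd Φ b' n :=
  fun A h1 h2 h3 => h A h1 h2 fun x hx => (h3 x hx).trans hb

lemma final_bd [CompleteSpace X] {Φ : X → ℝ} (hC1 : ContDiff ℝ 1 Φ) (heven : ∀ u, Φ (-u) = Φ u)
    (hPS : PSC Φ) {m0 : ℝ} (hm0 : ∀ u, m0 ≤ Φ u) {a : ℝ} (ha : 0 < a)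
    (N1 : ∀ u, fderiv ℝ Φ u = 0 → Φ u < 0 → a < ‖u‖)
    (N2 : ∀ u, fderiv ℝ Φ u = 0 → Φ u ≤ 0 → ‖u‖ ≠ a) : ∃ n, ∀ b < 0, Bd Φ b n := by
  let T : Set ℝ := {c | c ≤ 0 ∧ ∃ n, ∀ b < 0, b ≤ c → Bd Φ b n}
  have hT0 : min (m0 - 1) (-1) ∈ T := by
    refine ⟨(min_le_right _ _).trans (by norm_num), 0, fun b _ hb A _ _ hA => ?_⟩
    refine ⟨fun _ => ∅, fun i => isClosed_empty, fun i x hx => hx.elim, fun x hx => ?_⟩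
    have := hA x hx
    have := hm0 x
    have := hb.trans (min_le_left _ _)
    linarith
  have hTb : BddAbove T := ⟨0, fun c hc => hc.1⟩
  have hs0 : sSup T ≤ 0 := csSup_le ⟨_, hT0⟩ fun c hc => hc.1
  obtain ⟨ε, hε, m, hcl⟩ := claim hC1 heven hPS hm0 ha N1 N2 hs0
  obtain ⟨c, ⟨hc0, n, hcn⟩, hcs⟩ := exists_lt_of_lt_csSup ⟨_, hT0⟩
    (show sSup T - ε < sSup T by linarith)
  have h1 : Bd Φ (sSup T - ε) n := hcn _ (by linarith) hcs.le
  have h2 := hcl n h1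
  have h3 : min (sSup T + ε) 0 ∈ T :=
    ⟨min_le_right _ _, n + m, fun b hb hbc => h2 b hb (hbc.trans (min_le_left _ _))⟩
  have h4 := le_csSup hTb h3
  have h5 : sSup T = 0 := by
    rcases min_cases (sSup T + ε) 0 with h | h
    · linarith
    · linarith
  exact ⟨n + m, fun b hb => h2 b hb (by linarith)⟩

end Final
end ClarkExt

/-- Extension of Clark's theorem (Liu–Wang): an even, bounded-below C¹ functional
satisfying the Palais–Smale condition, vanishing at 0, whose restriction to small
spheres of k-dimensional subspaces has negative supremum for every k, admits either
a sequence of negative critical points tending to 0 in norm, or a whole small range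
of critical points at level 0. -/
theorem clark_extension {X : Type*} [NormedAddCommGroup X] [NormedSpace ℝ X]
    [CompleteSpace X]
    (Φ : X → ℝ) (hC1 : ContDiff ℝ 1 Φ)
    (heven : ∀ u : X, Φ (-u) = Φ u)
    (hbdd : ∃ m : ℝ, ∀ u : X, m ≤ Φ u)
    (h0 : Φ 0 = 0)
    (hPS : ∀ u : ℕ → X, (∃ M : ℝ, ∀ n, |Φ (u n)| ≤ M) →
      Tendsto (fun n => ‖fderiv ℝ Φ (u n)‖) atTop (𝓝 0) →
      ∃ σ : ℕ → ℕ, StrictMono σ ∧ ∃ x : X, Tendsto (u ∘ σ) atTop (𝓝 x))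
    (hsub : ∀ k : ℕ, 1 ≤ k → ∃ (Xk : Submodule ℝ X) (ρk : ℝ),
      Module.finrank ℝ Xk = k ∧ 0 < ρk ∧
      sSup (Φ '' {u : X | u ∈ Xk ∧ ‖u‖ = ρk}) < 0) :
    (∃ u : ℕ → X, (∀ k : ℕ, fderiv ℝ Φ (u k) = 0 ∧ Φ (u k) < 0) ∧
      Tendsto (fun k => ‖u k‖) atTop (𝓝 0)) ∨
    (∃ r : ℝ, 0 < r ∧ ∀ a : ℝ, 0 < a → a < r →
      ∃ u : X, fderiv ℝ Φ u = 0 ∧ ‖u‖ = a ∧ Φ u = 0) := by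
  by_contra hcon
  push Not at hcon
  obtain ⟨hi, hii⟩ := hcon
  obtain ⟨m0, hm0⟩ := hbdd
  have hδ : ∃ δ > 0, ∀ u : X, fderiv ℝ Φ u = 0 → Φ u < 0 → δ ≤ ‖u‖ := by
    by_contra hc
    push Not at hc
    choose u hu1 hu2 hu3 using fun n : ℕ => hc (1 / ((n : ℝ) + 1)) (by positivity)
    exact hi u (fun k => ⟨hu1 k, hu2 k⟩) (squeeze_zero (fun n => norm_nonneg _)
      (fun n => (hu3 n).le) tendsto_one_div_add_atTop_nhds_zero_nat)
  obtain ⟨δ, hδ0, hδ⟩ := hδ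
  obtain ⟨a, ha0, haδ, ha⟩ := hii δ hδ0
  obtain ⟨n, hn⟩ := ClarkExt.final_bd hC1 heven hPS hm0 ha0
    (fun u h1 h2 => haδ.trans_le (hδ u h1 h2))
    (fun u h1 h2 h3 => by
      rcases h2.lt_or_eq with h | h
      · linarith [hδ u h1 h]
      · exact ha u h1 h3 h)
  obtain ⟨V, ρ, hV, hρ, hsup⟩ := hsub (n + 1) (by omega)
  have : FiniteDimensional ℝ V := Module.finite_of_finrank_pos (by omega)
  have hS : IsCompact {u : X | u ∈ V ∧ ‖u‖ = ρ} := by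
    have h1 := (isCompact_sphere (0 : V) ρ).image continuous_subtype_val
    convert h1 using 1
    ext u
    simp only [Set.mem_image, mem_sphere_iff_norm, sub_zero]
    constructor
    · rintro ⟨h2, h3⟩
      exact ⟨⟨u, h2⟩, h3, rfl⟩
    · rintro ⟨v, hv, rfl⟩
      exact ⟨v.2, hv⟩
  refine ClarkExt.sphere_not_gen V hV hρ (hn _ hsup _ hS ?_ ?_)
  · rintro x ⟨h1, h2⟩
    exact ⟨V.neg_mem h1, by rw [norm_neg, h2]⟩
  · intro x hx
    exact le_csSup (hS.image hC1.continuous).bddAbove ⟨x, hx, rfl⟩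
end

section
/- Let u : ℝ³ → ℝ be a smooth compactly supported function and define φ_u(x) = (1/(4π)) ∫_{ℝ³} u(y)² / ‖x − y‖ dy. Then φ_u is twice continuously differentiable on ℝ³ and its Laplacian satisfies Δφ_u(x) = −u(x)² for every x ∈ ℝ³. -/
open MeasureTheory

/-- The Laplacian of `f : ℝ³ → ℝ` at `x`: the sum of the three pure second partial
derivatives, i.e. the trace of the second Fréchet derivative in the standard basis. -/
noncomputable def laplacian3 (f : EuclideanSpace ℝ (Fin 3) → ℝ)
    (x : EuclideanSpace ℝ (Fin 3)) : ℝ :=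
  ∑ i : Fin 3,
    fderiv ℝ (fderiv ℝ f) x (EuclideanSpace.single i (1 : ℝ))
      (EuclideanSpace.single i (1 : ℝ))

open Filter Topology Set

lemma np_locInt : LocallyIntegrable (fun y : (EuclideanSpace ℝ (Fin 3)) => ‖y‖⁻¹) := by
  refine locallyIntegrable_of_norm_le_rpow (C := 1) (α := 1) (by simp) (by simp) ?_ ?_
  · refine Eventually.of_forall fun x => ?_
    simp [Real.rpow_neg_one]
  · exact (measurable_norm.inv).aestronglyMeasurable

/-- The basic power function. -/
noncomputable def npQ (t p : ℝ) (y : (EuclideanSpace ℝ (Fin 3))) : ℝ := (t ^ 2 + ‖y‖ ^ 2) ^ p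

lemma npQ_hasFDerivAt (t p : ℝ) (ht : 0 < t) (y : (EuclideanSpace ℝ (Fin 3))) :
    HasFDerivAt (npQ t p) ((2 * p * npQ t (p - 1) y) • (innerSL ℝ y)) y := by
  have h1 : HasFDerivAt (fun y : (EuclideanSpace ℝ (Fin 3)) => t ^ 2 + ‖y‖ ^ 2) (2 • (innerSL ℝ y)) y :=
    (hasStrictFDerivAt_norm_sq y).hasFDerivAt.const_add _
  have hpos : t ^ 2 + ‖y‖ ^ 2 ≠ 0 := by positivity
  have h2 := h1.rpow_const (p := p) (Or.inl hpos)
  convert! h2 using 1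
  ext v
  simp [npQ]
  ring

lemma npQ_contDiff (t p : ℝ) (ht : 0 < t) : ContDiff ℝ 1 (npQ t p) := by
  unfold npQ
  refine ContDiff.rpow_const_of_ne (contDiff_const.add (contDiff_norm_sq ℝ)) fun y => ?_
  positivity

lemma npQ_deriv (t p : ℝ) (ht : 0 < t) (y : (EuclideanSpace ℝ (Fin 3))) (i : Fin 3) :
    fderiv ℝ (npQ t p) y (EuclideanSpace.single i (1 : ℝ)) = 2 * p * npQ t (p - 1) y * y i := by
  rw [(npQ_hasFDerivAt t p ht y).fderiv]
  simp [EuclideanSpace.inner_single_right]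

lemma npQ_deriv2 (t p : ℝ) (ht : 0 < t) (y : (EuclideanSpace ℝ (Fin 3))) (i : Fin 3) :
    fderiv ℝ (fun y => npQ t p y * y i) y (EuclideanSpace.single i (1 : ℝ)) =
      npQ t p y + 2 * p * npQ t (p - 1) y * y i ^ 2 := by
  have h2 : HasFDerivAt (fun y : (EuclideanSpace ℝ (Fin 3)) => y i) (EuclideanSpace.proj i : (EuclideanSpace ℝ (Fin 3)) →L[ℝ] ℝ) y :=
    (EuclideanSpace.proj i : (EuclideanSpace ℝ (Fin 3)) →L[ℝ] ℝ).hasFDerivAt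
  have h3 : HasFDerivAt (fun y : (EuclideanSpace ℝ (Fin 3)) => npQ t p y * y i) _ y := (npQ_hasFDerivAt t p ht y).mul h2
  rw [h3.fderiv]
  simp [EuclideanSpace.inner_single_right]
  ring

lemma np_ibp (f g : (EuclideanSpace ℝ (Fin 3)) → ℝ) (hf : ContDiff ℝ 1 f) (hg : ContDiff ℝ 1 g)
    (hc : HasCompactSupport g) (v : (EuclideanSpace ℝ (Fin 3))) :
    ∫ x, f x * fderiv ℝ g x v = - ∫ x, fderiv ℝ f x v * g x := by
  have hf' : Continuous (fun x => fderiv ℝ f x v) :=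
    (hf.continuous_fderiv one_ne_zero).clm_apply continuous_const
  have hg' : Continuous (fun x => fderiv ℝ g x v) :=
    (hg.continuous_fderiv one_ne_zero).clm_apply continuous_const
  refine integral_mul_fderiv_eq_neg_fderiv_mul_of_integrable ?_ ?_ ?_ ?_ ?_
  · exact (hf'.mul hg.continuous).integrable_of_hasCompactSupport hc.mul_left
  · exact (hf.continuous.mul hg').integrable_of_hasCompactSupport
      ((hc.fderiv_apply ℝ v).mul_left)
  · exact (hf.continuous.mul hg.continuous).integrable_of_hasCompactSupport hc.mul_left
  · exact fun x _ => (hf.differentiable one_ne_zero).differentiableAt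
  · exact fun x _ => (hg.differentiable one_ne_zero).differentiableAt

lemma np_partial_contDiff (g : (EuclideanSpace ℝ (Fin 3)) → ℝ) (hg : ContDiff ℝ 2 g) (v : (EuclideanSpace ℝ (Fin 3))) :
    ContDiff ℝ 1 (fun x => fderiv ℝ g x v) :=
  (hg.fderiv_right (m := 1) (by norm_num)).clm_apply contDiff_const

lemma np_second (g : (EuclideanSpace ℝ (Fin 3)) → ℝ) (hg : ContDiff ℝ 2 g) (x v : (EuclideanSpace ℝ (Fin 3))) :
    fderiv ℝ (fderiv ℝ g) x v v = fderiv ℝ (fun x => fderiv ℝ g x v) x v := by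
  have h : DifferentiableAt ℝ (fderiv ℝ g) x :=
    ((hg.fderiv_right (m := 1) (by norm_num)).differentiable one_ne_zero).differentiableAt
  rw [fderiv_clm_apply h (differentiableAt_const v)]
  simp

lemma np_lap_cont (g : (EuclideanSpace ℝ (Fin 3)) → ℝ) (hg : ContDiff ℝ 2 g) : Continuous (laplacian3 g) := by
  unfold laplacian3
  refine continuous_finsetSum _ fun i _ => ?_
  exact ((((hg.fderiv_right (m := 1) (by norm_num)).continuous_fderiv one_ne_zero).clm_apply
    continuous_const).clm_apply continuous_const)

lemma np_lap_supp (g : (EuclideanSpace ℝ (Fin 3)) → ℝ) (hc : HasCompactSupport g) : HasCompactSupport (laplacian3 g) := by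
  refine ((hc.fderiv ℝ).fderiv ℝ).mono fun x hx => ?_
  rw [Function.mem_support] at hx ⊢
  intro h
  apply hx
  simp [laplacian3, h]

lemma np_green (t : ℝ) (ht : 0 < t) (g : (EuclideanSpace ℝ (Fin 3)) → ℝ) (hg : ContDiff ℝ 2 g)
    (hc : HasCompactSupport g) :
    ∫ y, npQ t (-1/2) y * laplacian3 g y = - ∫ y, 3 * t ^ 2 * npQ t (-5/2) y * g y := by
  have hg1 : ContDiff ℝ 1 g := hg.of_le (by norm_num)
  have key : ∀ i : Fin 3, ∫ y, npQ t (-1/2) y * fderiv ℝ (fderiv ℝ g) y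
      (EuclideanSpace.single i (1 : ℝ)) (EuclideanSpace.single i (1 : ℝ)) =
      - ∫ y, (npQ t (-3/2) y - 3 * npQ t (-5/2) y * y i ^ 2) * g y := by
    intro i
    have hN3 : ContDiff ℝ 1 (fun y : (EuclideanSpace ℝ (Fin 3)) => npQ t (-3/2) y * y i) :=
      (npQ_contDiff t _ ht).mul (EuclideanSpace.proj i : (EuclideanSpace ℝ (Fin 3)) →L[ℝ] ℝ).contDiff
    simp_rw [np_second g hg]
    rw [np_ibp _ _ (npQ_contDiff t _ ht) (np_partial_contDiff g hg _) (hc.fderiv_apply ℝ _)]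
    simp_rw [npQ_deriv t _ ht]
    have := np_ibp _ _ hN3 hg1 hc (EuclideanSpace.single i (1 : ℝ))
    simp_rw [npQ_deriv2 t _ ht] at this
    rw [← integral_neg]
    norm_num at this ⊢
    rw [this]
    simp only [sub_eq_add_neg]
  have hint : ∀ i : Fin 3, Integrable (fun y => npQ t (-1/2) y * fderiv ℝ (fderiv ℝ g) y
      (EuclideanSpace.single i (1 : ℝ)) (EuclideanSpace.single i (1 : ℝ))) := by
    intro i
    simp_rw [np_second g hg]
    refine Continuous.integrable_of_hasCompactSupport ((npQ_contDiff t _ ht).continuous.mul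
      (((np_partial_contDiff g hg _).continuous_fderiv one_ne_zero).clm_apply
        continuous_const)) ?_
    exact ((hc.fderiv_apply ℝ _).fderiv_apply ℝ _).mul_left
  have hint2 : ∀ i : Fin 3, Integrable
      (fun y : (EuclideanSpace ℝ (Fin 3)) => (npQ t (-3/2) y - 3 * npQ t (-5/2) y * y i ^ 2) * g y) := by
    intro i
    refine Continuous.integrable_of_hasCompactSupport ?_ hc.mul_left
    have h3 := (npQ_contDiff t (-3/2) ht).continuous
    have h5 := (npQ_contDiff t (-5/2) ht).continuous
    have hgc := hg.continuous
    fun_prop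
  simp_rw [laplacian3, Finset.mul_sum]
  rw [integral_finsetSum _ fun i _ => hint i]
  simp_rw [key]
  rw [Finset.sum_neg_distrib, ← integral_finsetSum _ fun i _ => hint2 i]
  congr 1
  apply integral_congr_ae
  refine Eventually.of_forall fun y => ?_
  have hq : npQ t (-3/2) y = (t ^ 2 + ‖y‖ ^ 2) * npQ t (-5/2) y := by
    have hpos : 0 < t ^ 2 + ‖y‖ ^ 2 := by positivity
    unfold npQ
    rw [show (-3/2 : ℝ) = 1 + (-5/2) by norm_num, Real.rpow_add hpos, Real.rpow_one]
  have hn : ‖y‖ ^ 2 = ∑ i, y i ^ 2 := EuclideanSpace.real_norm_sq_eq y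
  simp only [hq]
  simp only [hn, Fin.sum_univ_three]
  ring

lemma np_scale (t : ℝ) (ht : 0 < t) (g : (EuclideanSpace ℝ (Fin 3)) → ℝ) :
    ∫ y, 3 * t ^ 2 * npQ t (-5/2) y * g y = ∫ z, 3 * npQ 1 (-5/2) z * g (t • z) := by
  have h := Measure.integral_comp_smul_of_nonneg (volume : Measure (EuclideanSpace ℝ (Fin 3)))
    (fun y => 3 * t ^ 2 * npQ t (-5/2) y * g y) t (hR := ht.le)
  have h2 : ∀ z : (EuclideanSpace ℝ (Fin 3)), 3 * t ^ 2 * npQ t (-5/2) (t • z) * g (t • z) =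
      (t ^ 3)⁻¹ * (3 * npQ 1 (-5/2) z * g (t • z)) := by
    intro z
    have : npQ t (-5/2) (t • z) = (t ^ 5)⁻¹ * npQ 1 (-5/2) z := by
      unfold npQ
      rw [norm_smul, Real.norm_of_nonneg ht.le,
        show t ^ 2 + (t * ‖z‖) ^ 2 = t ^ 2 * (1 ^ 2 + ‖z‖ ^ 2) by ring,
        Real.mul_rpow (by positivity) (by positivity), ← Real.rpow_natCast t 2,
        ← Real.rpow_mul ht.le, ← Real.rpow_natCast t 5, ← Real.rpow_neg ht.le]
      norm_num
    rw [this]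
    field_simp
  simp_rw [h2] at h
  rw [integral_const_mul] at h
  simp only [finrank_euclideanSpace, Fintype.card_fin, smul_eq_mul] at h
  have h3 : (t ^ 3)⁻¹ ≠ 0 := by positivity
  exact (mul_left_cancel₀ h3 h).symm

lemma np_integrable : Integrable (fun z : (EuclideanSpace ℝ (Fin 3)) => 3 * npQ 1 (-5/2) z) := by
  have := integrable_rpow_neg_one_add_norm_sq (E := (EuclideanSpace ℝ (Fin 3))) (μ := volume) (r := 5) (by norm_num)
  simpa [npQ] using this.const_mul 3

lemma np_radial : ∫ z : (EuclideanSpace ℝ (Fin 3)), 3 * npQ 1 (-5/2) z = 4 * Real.pi := by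
  have h := integral_fun_norm_addHaar (volume : Measure (EuclideanSpace ℝ (Fin 3)))
    (fun r : ℝ => 3 * (1 + r ^ 2) ^ (-5/2 : ℝ))
  have hv : (volume : Measure (EuclideanSpace ℝ (Fin 3))).real (Metric.ball 0 1) = 4 / 3 * Real.pi := by
    rw [Measure.real, EuclideanSpace.volume_ball_fin_three]
    simp only [ENNReal.ofReal_one, one_pow, one_mul]
    rw [ENNReal.toReal_ofReal (by positivity)]
    ring
  have hI : ∫ r in Ioi (0 : ℝ), r ^ 2 * (3 * (1 + r ^ 2) ^ (-5/2 : ℝ)) = 1 := by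
    have hd : ∀ r ∈ Ici (0 : ℝ), HasDerivAt (fun r : ℝ => r ^ 3 * (1 + r ^ 2) ^ (-3/2 : ℝ))
        (r ^ 2 * (3 * (1 + r ^ 2) ^ (-5/2 : ℝ))) r := by
      intro r _
      have hpos : 0 < 1 + r ^ 2 := by positivity
      have h1 : HasDerivAt (fun r : ℝ => 1 + r ^ 2) (2 * r) r := by
        simpa using (hasDerivAt_pow 2 r).const_add 1
      have h2 := (hasDerivAt_pow 3 r).mul (h1.rpow_const (p := (-3/2 : ℝ)) (Or.inl hpos.ne'))
      convert! h2 using 1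
      rw [show (-3/2 : ℝ) = 1 + (-5/2) by norm_num, Real.rpow_add hpos, Real.rpow_one]
      norm_num
      ring
    have hl : Tendsto (fun r : ℝ => r ^ 3 * (1 + r ^ 2) ^ (-3/2 : ℝ)) atTop (𝓝 1) := by
      have e : (fun r : ℝ => ((r ^ 2)⁻¹ + 1) ^ (-3/2 : ℝ)) =ᶠ[atTop]
          (fun r : ℝ => r ^ 3 * (1 + r ^ 2) ^ (-3/2 : ℝ)) := by
        filter_upwards [eventually_gt_atTop 0] with r hr
        rw [show 1 + r ^ 2 = r ^ 2 * ((r ^ 2)⁻¹ + 1) by field_simp,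
          Real.mul_rpow (by positivity) (by positivity), ← Real.rpow_natCast r 2,
          ← Real.rpow_mul hr.le, ← Real.rpow_natCast r 3, ← mul_assoc, ← Real.rpow_add hr]
        norm_num
      refine Tendsto.congr' e ?_
      have h1 : Tendsto (fun r : ℝ => (r ^ 2)⁻¹ + 1) atTop (𝓝 (0 + 1)) :=
        ((tendsto_pow_atTop two_ne_zero).inv_tendsto_atTop).add_const 1
      simpa using h1.rpow_const (p := (-3/2 : ℝ)) (Or.inl (by norm_num))
    rw [integral_Ioi_of_hasDerivAt_of_nonneg' hd (fun r _ => by positivity) hl]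
    simp
  simp only [finrank_euclideanSpace, Fintype.card_fin, smul_eq_mul, nsmul_eq_mul] at h
  norm_num at h hI
  rw [hI, hv] at h
  simp only [npQ]
  norm_num
  rw [h]
  ring

lemma np_limit_right (g : (EuclideanSpace ℝ (Fin 3)) → ℝ) (hg : Continuous g) (hc : HasCompactSupport g) :
    Tendsto (fun n : ℕ => ∫ z, 3 * npQ 1 (-5/2) z * g ((1 / ((n : ℝ) + 1)) • z)) atTop
      (𝓝 (4 * Real.pi * g 0)) := by
  obtain ⟨C, hC⟩ := hg.bounded_above_of_compact_support hc
  rw [← np_radial, ← integral_mul_const]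
  have hq := (npQ_contDiff 1 (-5/2) one_pos).continuous
  refine tendsto_integral_of_dominated_convergence (fun z => 3 * npQ 1 (-5/2) z * C) ?_ ?_ ?_ ?_
  · intro n
    exact Continuous.aestronglyMeasurable (by fun_prop)
  · exact np_integrable.mul_const C
  · intro n
    refine Eventually.of_forall fun z => ?_
    have : 0 ≤ 3 * npQ 1 (-5/2) z := by unfold npQ; positivity
    rw [norm_mul, Real.norm_of_nonneg this]
    exact mul_le_mul_of_nonneg_left (hC _) this
  · refine Eventually.of_forall fun z => ?_
    refine Tendsto.const_mul _ ?_
    have h : Tendsto (fun n : ℕ => (1 / ((n : ℝ) + 1)) • z) atTop (𝓝 ((0 : ℝ) • z)) :=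
      tendsto_one_div_add_atTop_nhds_zero_nat.smul_const z
    rw [zero_smul] at h
    exact (hg.tendsto 0).comp h

lemma np_limit_left (g : (EuclideanSpace ℝ (Fin 3)) → ℝ) (hg : Continuous g) (hc : HasCompactSupport g) :
    Tendsto (fun n : ℕ => ∫ z, npQ (1 / ((n : ℝ) + 1)) (-1/2) z * g z) atTop
      (𝓝 (∫ z, ‖z‖⁻¹ * g z)) := by
  have hb : Integrable (fun z : (EuclideanSpace ℝ (Fin 3)) => ‖z‖⁻¹ * ‖g z‖) := by
    have := np_locInt.integrable_smul_right_of_hasCompactSupport hg.norm hc.norm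
    simpa using this
  have hz : ∀ᵐ z : (EuclideanSpace ℝ (Fin 3)), z ≠ 0 := by
    simp [ae_iff]
  refine tendsto_integral_of_dominated_convergence (fun z => ‖z‖⁻¹ * ‖g z‖) ?_ hb ?_ ?_
  · intro n
    exact ((npQ_contDiff _ _ (by positivity)).continuous.mul hg).aestronglyMeasurable
  · intro n
    filter_upwards [hz] with z hz
    have hz' : 0 < ‖z‖ := norm_pos_iff.2 hz
    rw [norm_mul]
    refine mul_le_mul_of_nonneg_right ?_ (norm_nonneg _)
    unfold npQ
    rw [Real.norm_of_nonneg (by positivity)]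
    calc _ ≤ (‖z‖ ^ 2) ^ (-1/2 : ℝ) := by
          apply Real.rpow_le_rpow_of_nonpos (by positivity) _ (by norm_num)
          nlinarith [sq_nonneg (1 / ((n : ℝ) + 1))]
      _ = ‖z‖⁻¹ := by
          rw [← Real.rpow_natCast, ← Real.rpow_mul hz'.le]
          norm_num [Real.rpow_neg_one]
  · filter_upwards [hz] with z hz
    have hz' : 0 < ‖z‖ := norm_pos_iff.2 hz
    refine Tendsto.mul_const _ ?_
    have h : Tendsto (fun n : ℕ => (1 / ((n : ℝ) + 1)) ^ 2 + ‖z‖ ^ 2) atTop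
        (𝓝 ((0 : ℝ) ^ 2 + ‖z‖ ^ 2)) :=
      (tendsto_one_div_add_atTop_nhds_zero_nat.pow 2).add_const _
    have h2 := h.rpow_const (p := (-1/2 : ℝ)) (Or.inl (by positivity))
    have e : ((0 : ℝ) ^ 2 + ‖z‖ ^ 2) ^ (-1/2 : ℝ) = ‖z‖⁻¹ := by
      rw [zero_pow two_ne_zero, zero_add, ← Real.rpow_natCast, ← Real.rpow_mul hz'.le]
      norm_num [Real.rpow_neg_one]
    rw [e] at h2
    exact h2

lemma np_fundamental (g : (EuclideanSpace ℝ (Fin 3)) → ℝ) (hg : ContDiff ℝ 2 g) (hc : HasCompactSupport g) :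
    ∫ y, ‖y‖⁻¹ * laplacian3 g y = - (4 * Real.pi * g 0) := by
  have h1 := np_limit_left _ (np_lap_cont g hg) (np_lap_supp g hc)
  have h2 := (np_limit_right g hg.continuous hc).neg
  refine tendsto_nhds_unique h1 (h2.congr fun n => ?_)
  rw [np_green _ (by positivity) g hg hc, np_scale _ (by positivity)]

lemma np_lap_translate (f : (EuclideanSpace ℝ (Fin 3)) → ℝ) (x y : (EuclideanSpace ℝ (Fin 3))) :
    laplacian3 (fun z => f (x + z)) y = laplacian3 f (x + y) := by
  unfold laplacian3
  have : fderiv ℝ (fun z => f (x + z)) = fun z => fderiv ℝ f (x + z) := by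
    ext1 z
    exact fderiv_comp_add_left x
  rw [this, fderiv_comp_add_left]

open scoped Convolution in
lemma np_conv (f : (EuclideanSpace ℝ (Fin 3)) → ℝ) (hf : ContDiff ℝ 2 f) (hc : HasCompactSupport f) (x : (EuclideanSpace ℝ (Fin 3))) :
    laplacian3 ((fun y : (EuclideanSpace ℝ (Fin 3)) => ‖y‖⁻¹) ⋆[ContinuousLinearMap.mul ℝ ℝ, volume] f) x =
      ∫ y, ‖y‖⁻¹ * laplacian3 f (x - y) := by
  have hf1 : ContDiff ℝ 1 f := hf.of_le (by norm_num)
  have hf' : ContDiff ℝ 1 (fderiv ℝ f) := hf.fderiv_right (m := 1) (by norm_num)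
  have hc' := hc.fderiv ℝ
  have hc'' := hc'.fderiv ℝ
  have hf'' := hf'.continuous_fderiv one_ne_zero
  set L := ContinuousLinearMap.mul ℝ ℝ
  have e1 : fderiv ℝ ((fun y : (EuclideanSpace ℝ (Fin 3)) => ‖y‖⁻¹) ⋆[L, volume] f) =
      ((fun y : (EuclideanSpace ℝ (Fin 3)) => ‖y‖⁻¹) ⋆[L.precompR (EuclideanSpace ℝ (Fin 3)), volume] fderiv ℝ f) := by
    ext1 z
    exact (hc.hasFDerivAt_convolution_right L np_locInt hf1 z).fderiv
  have hint : ∀ v : (EuclideanSpace ℝ (Fin 3)), Integrable fun y => ‖y‖⁻¹ * fderiv ℝ (fderiv ℝ f) (x - y) v v := by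
    intro v
    have h0 : HasCompactSupport (fun a => fderiv ℝ (fderiv ℝ f) a v v) := by
      refine hc''.mono fun a ha => ?_
      rw [Function.mem_support] at ha ⊢
      intro h
      apply ha
      simp [h]
    exact (h0.convolutionExists_right L np_locInt
      ((hf''.clm_apply continuous_const).clm_apply continuous_const) x)
  unfold laplacian3
  simp_rw [Finset.mul_sum]
  rw [integral_finsetSum _ fun i _ => hint _, e1]
  refine Finset.sum_congr rfl fun i _ => ?_
  rw [(hc'.hasFDerivAt_convolution_right (L.precompR (EuclideanSpace ℝ (Fin 3))) np_locInt hf' x).fderiv,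
    convolution_precompR_apply _ np_locInt hc'' hf'',
    convolution_precompR_apply _ np_locInt (hc''.mono fun a ha => ?_)
      (hf''.clm_apply continuous_const)]
  · rfl
  · rw [Function.mem_support] at ha ⊢
    intro h
    apply ha
    simp [h]

theorem newtonian_potential_poisson (u : EuclideanSpace ℝ (Fin 3) → ℝ)
    (hu : ContDiff ℝ (⊤ : ℕ∞) u) (hsupp : HasCompactSupport u)
    (φ : EuclideanSpace ℝ (Fin 3) → ℝ)
    (hφ : ∀ x : EuclideanSpace ℝ (Fin 3),
      φ x = (1 / (4 * Real.pi)) *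
        ∫ y : EuclideanSpace ℝ (Fin 3), u y ^ 2 / ‖x - y‖) :
    ContDiff ℝ 2 φ ∧ ∀ x : EuclideanSpace ℝ (Fin 3), laplacian3 φ x = -(u x ^ 2) := by
  have hu2 : ContDiff ℝ 2 u := hu.of_le (by norm_cast)
  set c : ℝ := 1 / (4 * Real.pi) with hcdef
  set f : (EuclideanSpace ℝ (Fin 3)) → ℝ := fun y => c * u y ^ 2 with hfdef
  have hf : ContDiff ℝ 2 f := contDiff_const.mul (hu2.pow 2)
  have hc : HasCompactSupport f := by
    refine hsupp.mono fun a ha => ?_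
    rw [Function.mem_support] at ha ⊢
    intro h
    apply ha
    simp [hfdef, h]
  have e : φ = MeasureTheory.convolution (fun y : (EuclideanSpace ℝ (Fin 3)) => ‖y‖⁻¹) f
      (ContinuousLinearMap.mul ℝ ℝ) volume := by
    ext1 x
    rw [hφ, convolution_eq_swap, ← integral_const_mul]
    refine integral_congr_ae (Eventually.of_forall fun y => ?_)
    simp only [hfdef, ContinuousLinearMap.mul_apply', div_eq_mul_inv]
    ring
  refine ⟨?_, fun x => ?_⟩
  · rw [e]
    exact hc.contDiff_convolution_right (n := 2) _ np_locInt hf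
  · rw [e, np_conv f hf hc, ← integral_neg_eq_self]
    have h := np_fundamental (fun z => f (x + z)) (hf.comp (contDiff_const.add contDiff_id))
      (hc.comp_homeomorph (Homeomorph.addLeft x))
    simp_rw [np_lap_translate] at h
    simp only [norm_neg, sub_neg_eq_add]
    rw [h]
    simp only [hfdef, hcdef, add_zero]
    field_simp
end
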